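/- Let K be a field, E a finite set, and W ⊆ K^E a configuration realizing a connected matroid M of rank at least 2. Then the ideal M_W of submaximal minors of the configuration form Q_W has height 3 in K[x_e : e ∈ E] and the quotient K[x]/M_W is a Cohen–Macaulay ring (in particular pure-dimensional of codimension 3); moreover the Jacobian ideal J_W is equidimensional of height 3, i.e., every minimal prime of K[x] over J_W has height 3. -/

import Mathlib

open scoped BigOperators

namespace Config

variable {K : Type} [Field K] {E : Type} [Fintype E] [DecidableEq E]

/-- The coordinate functional `e^∨` of `K^E` restricted to a subspace `W ⊆ K^E`. -/
noncomputable def coordFun (W : Submodule K (E → K)) (e : E) : W →ₗ[K] K :=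
  (LinearMap.proj e).comp W.subtype

/-- `S ⊆ E` is independent in the matroid `M_W` realized by the configuration `W`:
the restricted coordinate functionals `(e^∨|_W)_{e ∈ S}` are linearly independent. -/
def Indep (W : Submodule K (E → K)) (S : Finset E) : Prop :=
  LinearIndependent K (fun e : S => coordFun W e)

/-- A circuit of the matroid `M_W`: a minimal dependent subset of `E`. -/
def IsCircuit (W : Submodule K (E → K)) (C : Finset E) : Prop :=
  ¬ Indep W C ∧ ∀ D ⊂ C, Indep W D

/-- The matroid `M_W` is connected: the ground set is nonempty and any two distinct
elements lie on a common circuit. -/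
def Connected (W : Submodule K (E → K)) : Prop :=
  Nonempty E ∧ ∀ e f : E, e ≠ f → ∃ C : Finset E, IsCircuit W C ∧ e ∈ C ∧ f ∈ C

/-- `w` is a (linear) basis of the configuration `W ⊆ K^E`. -/
def IsBasisOf {r : ℕ} (w : Fin r → E → K) (W : Submodule K (E → K)) : Prop :=
  LinearIndependent K w ∧ Submodule.span K (Set.range w) = W

/-- The configuration (bilinear) form `Q_W` computed from the basis `w`: the symmetric
`r × r` matrix with entries `∑_{e ∈ E} x_e · w^i_e · w^j_e` over `K[x_e : e ∈ E]`. -/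
noncomputable def Qform {r : ℕ} (w : Fin r → E → K) :
    Matrix (Fin r) (Fin r) (MvPolynomial E K) :=
  Matrix.of fun i j => ∑ e : E, MvPolynomial.C (w i e * w j e) * MvPolynomial.X e

/-- The coefficient `c_{W,B} = (det (w^i_e)_{1≤i≤r, e∈B})²`, the squared determinant of
the `r × r` submatrix of the coefficient matrix of `w` with column set `B` (the square
is independent of the chosen ordering of the columns). -/
noncomputable def cSq {r : ℕ} (w : Fin r → E → K) (B : Finset E) : K :=
  if h : B.card = r then
    (Matrix.det (Matrix.of fun i j : Fin r =>
      w i ((Finset.equivFinOfCardEq h).symm j : E))) ^ 2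
  else 0

/-- The configuration polynomial `ψ_W = ∑_B c_{W,B} · x^B` computed from the basis `w`
(the coefficient `c_{W,B}` vanishes unless `B` is a basis of the matroid `M_W`). -/
noncomputable def psi {r : ℕ} (w : Fin r → E → K) : MvPolynomial E K :=
  ∑ B ∈ Finset.univ.powersetCard r,
    MvPolynomial.C (cSq w B) * ∏ e ∈ B, MvPolynomial.X e

/-- The ideal `M_W` generated by the submaximal, i.e. `(r−1) × (r−1)`, minors of the
configuration form `Q_W`. -/
noncomputable def minorIdeal {r : ℕ} (w : Fin r → E → K) : Ideal (MvPolynomial E K) :=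
  Ideal.span {p | ∃ f g : Fin (r - 1) ↪ Fin r, p = Matrix.det ((Qform w).submatrix f g)}

/-- The Jacobian ideal `J_W = ⟨ψ_W⟩ + ⟨∂ψ_W/∂x_e : e ∈ E⟩`. -/
noncomputable def jacIdeal {r : ℕ} (w : Fin r → E → K) : Ideal (MvPolynomial E K) :=
  Ideal.span ({psi w} ∪ Set.range fun e => MvPolynomial.pderiv e (psi w))

/-- The height of a prime ideal `p`: the supremum of lengths of chains of primes below `p`. -/
noncomputable def htP {R : Type} [CommRing R] (p : Ideal R) (hp : p.IsPrime) : ℕ∞ :=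
  Order.height (⟨p, hp⟩ : PrimeSpectrum R)

/-- The height of an ideal: the infimum of the heights of the primes containing it. -/
noncomputable def htI {R : Type} [CommRing R] (I : Ideal R) : ℕ∞ :=
  ⨅ (p : PrimeSpectrum R) (_ : I ≤ p.asIdeal), Order.height p

/-- `rs` is a regular sequence in the commutative ring `R`: it generates a proper ideal
and each entry is a nonzerodivisor modulo the preceding ones. -/
def IsRegSeq {R : Type} [CommRing R] (rs : List R) : Prop :=
  Ideal.span {x : R | x ∈ rs} ≠ ⊤ ∧
  ∀ (i : ℕ) (h : i < rs.length), ∀ y : R,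
    y * rs.get ⟨i, h⟩ ∈ Ideal.span {x : R | x ∈ rs.take i} →
      y ∈ Ideal.span {x : R | x ∈ rs.take i}

/-- A (Noetherian) commutative ring is Cohen–Macaulay if for every maximal ideal `m`
the maximal length of a regular sequence contained in `m` equals the height of `m`. -/
def IsCohenMacaulayRing (R : Type) [CommRing R] : Prop :=
  ∀ (m : Ideal R) (hm : m.IsMaximal),
    (⨆ l ∈ {l : List R | (∀ x ∈ l, x ∈ m) ∧ IsRegSeq l}, (l.length : ℕ∞))
      = htP m hm.isPrime

end Config

open scoped BigOperators
set_option linter.unusedSectionVars false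
namespace Config

section td
variable {K : Type*} [Field K] {L : Type*} [Field L] [Algebra K L]

/-- transcendence degree over `K` of a subset of `L`. -/
noncomputable def td (K : Type*) [Field K] {L : Type*} [Field L] [Algebra K L] (X : Set L) : ℕ∞ :=
  (AlgebraicIndependent.matroid K L).eRk X

lemma adjoin_le_closure (Y : Set L) :
    (IntermediateField.adjoin K Y : Set L) ⊆ (AlgebraicIndependent.matroid K L).closure Y := by
  rw [AlgebraicIndependent.matroid_closure_eq]
  intro a ha
  simp only [SetLike.mem_coe, Subalgebra.mem_algebraicClosure] at ha ⊢
  induction ha using IntermediateField.adjoin_induction with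
  | mem x hx => exact isAlgebraic_algebraMap (⟨x, Algebra.subset_adjoin hx⟩ : Algebra.adjoin K Y)
  | algebraMap x =>
    exact isAlgebraic_algebraMap (⟨algebraMap K L x, Subalgebra.algebraMap_mem _ _⟩ : Algebra.adjoin K Y)
  | add x y _ _ hx hy => exact hx.add hy
  | inv x _ hx => exact hx.inv
  | mul x y _ _ hx hy => exact hx.mul hy

lemma td_mono {X Y : Set L} (h : X ⊆ Y) : td K X ≤ td K Y := Matroid.eRk_mono _ h

lemma td_le_of_subset_adjoin {X Y : Set L} (h : X ⊆ IntermediateField.adjoin K Y) :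
    td K X ≤ td K Y := by
  unfold td
  rw [← Matroid.eRk_closure_eq _ Y]
  exact Matroid.eRk_mono _ (h.trans (adjoin_le_closure Y))

lemma td_union_le (X Y : Set L) : td K (X ∪ Y) ≤ td K X + td K Y :=
  Matroid.eRk_union_le_eRk_add_eRk _ _ _

lemma td_image_le {E : Type*} (x : E → L) (S : Finset E) : td K (x '' S) ≤ S.card := by
  refine (Matroid.eRk_le_encard _ _).trans ((Set.encard_image_le _ _).trans ?_)
  simp

lemma td_insert_le (a : L) (X : Set L) : td K (insert a X) ≤ td K X + 1 :=
  Matroid.eRk_insert_le_add_one _ _ _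

lemma td_insert_dichotomy (a : L) (X : Set L) : td K (insert a X) ≤ td K X ∨
    (a ∉ IntermediateField.adjoin K X ∧ ∀ Y ⊆ X, td K Y + 1 ≤ td K (insert a Y)) := by
  by_cases h : a ∈ (AlgebraicIndependent.matroid K L).closure X
  · left
    unfold td
    rw [← Matroid.eRk_closure_eq _ X]
    refine Matroid.eRk_mono _ (Set.insert_subset h ?_)
    exact Matroid.subset_closure _ _ (Set.subset_univ _)
  · right
    refine ⟨fun h' => h (adjoin_le_closure _ h'), fun Y hY => ?_⟩
    refine (Matroid.eRk_insert_eq_add_one ⟨Set.mem_univ _, fun h' => h ?_⟩).ge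
    exact Matroid.closure_subset_closure _ hY h'

end td

section rk
variable {K : Type*} [Field K] {V : Type*} [AddCommGroup V] [Module K V] [FiniteDimensional K V]
variable {E : Type*} [DecidableEq E]

/-- rank of a set of vectors -/
noncomputable def rk (K : Type*) [Field K] {V : Type*} [AddCommGroup V] [Module K V]
    {E : Type*} (v : E → V) (S : Finset E) : ℕ :=
  Module.finrank K (Submodule.span K (v '' S))

lemma rk_union_le (v : E → V) (A B : Finset E) : rk K v (A ∪ B) ≤ rk K v A + rk K v B := by
  unfold rk
  rw [Finset.coe_union, Set.image_union, Submodule.span_union]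
  exact Submodule.finrank_add_le_finrank_add_finrank _ _

/-- connectedness: no separations -/
def Conn (K : Type*) [Field K] {V : Type*} [AddCommGroup V] [Module K V]
    {E : Type*} [DecidableEq E] (v : E → V) (S : Finset E) : Prop :=
  ∀ A B : Finset E, A.Nonempty → B.Nonempty → Disjoint A B → A ∪ B = S →
    rk K v S < rk K v A + rk K v B

variable {L : Type*} [Field L] [Algebra K L]

/-- choose a basis from a finset of vectors, with dual functionals. -/
lemma exists_basis_sub (v : E → V) (S₀ S : Finset E) (h0 : S₀ ⊆ S)
    (hli : LinearIndepOn K v S₀) :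
    ∃ B ⊆ S, S₀ ⊆ B ∧ B.card = rk K v S ∧ LinearIndepOn K v B ∧
      Submodule.span K (v '' B) = Submodule.span K (v '' S) := by
  obtain ⟨b, hbS, h0b, hsp, hb⟩ := exists_linearIndepOn_extension hli (Finset.coe_subset.mpr h0)
  have hfin : b.Finite := S.finite_toSet.subset hbS
  lift b to Finset E using hfin
  have hspan : Submodule.span K (v '' b) = Submodule.span K (v '' S) :=
    le_antisymm (Submodule.span_mono (Set.image_mono hbS)) (Submodule.span_le.mpr hsp)
  refine ⟨b, by exact_mod_cast hbS, by exact_mod_cast h0b, ?_, hb, hspan⟩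
  unfold rk
  rw [← hspan]
  have := finrank_span_eq_card hb
  rw [Set.image_eq_range]
  simpa using this.symm

lemma exists_dual (v : E → V) (B : Finset E) (hB : LinearIndepOn K v B) :
    ∃ φ : E → V →ₗ[K] K, ∀ b ∈ B, ∀ c ∈ B, φ b (v c) = if c = b then 1 else 0 := by
  classical
  let bs := Module.Basis.extend (hB.linearIndepOn_id (R := K))
  have hmem : ∀ b ∈ B, v b ∈ hB.linearIndepOn_id.extend (Set.subset_univ _) := fun b hb =>
    hB.linearIndepOn_id.subset_extend _ ⟨⟨b, hb⟩, rfl⟩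
  refine ⟨fun b => if h : b ∈ B then bs.coord ⟨v b, hmem b h⟩ else 0, fun b hb c hc => ?_⟩
  have : v c = bs ⟨v c, hmem c hc⟩ := by simp [bs]
  simp only [hb, dif_pos]
  rw [this, Module.Basis.coord_apply, Module.Basis.repr_self, Finsupp.single_apply]
  simp only [Subtype.mk.injEq]
  have : v c = v b ↔ c = b := hB.injOn.eq_iff hc hb
  simp [this]

/-- relation lemma: vectors of relations have small transcendence degree -/
lemma td_relation (v : E → V) (S : Finset E) (y : E → L)
    (hy : ∀ φ : V →ₗ[K] L, ∑ f ∈ S, y f * φ (v f) = 0) :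
    td K (y '' S) + rk K v S ≤ S.card := by
  obtain ⟨B, hBS, -, hc, hli, -⟩ := exists_basis_sub (K := K) v ∅ S (by simp) (by simp)
  obtain ⟨φ, hφ⟩ := exists_dual v B hli
  have h1 : y '' S ⊆ IntermediateField.adjoin K (y '' ((S \ B : Finset E) : Set E)) := by
    rintro _ ⟨f, hf, rfl⟩
    have hf : f ∈ S := hf
    by_cases hfB : f ∈ B
    · have := hy ((Algebra.linearMap K L).comp (φ f))
      rw [← Finset.sum_sdiff hBS, Finset.sum_eq_single_of_mem f hfB] at this
      · simp only [LinearMap.comp_apply, hφ f hfB f hfB, if_true, map_one, Algebra.linearMap_apply,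
          mul_one] at this
        rw [eq_neg_of_add_eq_zero_right this]
        refine neg_mem (sum_mem fun i hi => mul_mem ?_ (IntermediateField.algebraMap_mem _ _))
        exact IntermediateField.subset_adjoin _ _ (Set.mem_image_of_mem _ hi)
      · intro b hb hbf
        simp [hφ f hfB b hb, hbf]
    · exact IntermediateField.subset_adjoin _ _ (Set.mem_image_of_mem _ (by simp [hf, hfB]))
  have h2 := (td_le_of_subset_adjoin h1).trans (td_image_le (K := K) y (S \ B))
  rw [← hc]
  calc _ ≤ ((S \ B).card : ℕ∞) + B.card := by gcongr
    _ = S.card := by rw [← Nat.cast_add, Finset.card_sdiff_add_card_eq_card hBS]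

/-- functional vanishing on `F` -/
lemma td_functional (v : E → V) (F S : Finset E) (hFS : F ⊆ S) (u : V →ₗ[K] L)
    (hF : ∀ f ∈ F, u (v f) = 0) (hne : ∃ f ∈ S, u (v f) ≠ 0) :
    ∃ c : L, c ≠ 0 ∧ td K ((fun f => c * u (v f)) '' S) + 1 + rk K v F ≤ rk K v S := by
  obtain ⟨B0, hB0F, -, hc0, hli0, -⟩ := exists_basis_sub (K := K) v ∅ F (by simp) (by simp)
  obtain ⟨B, hBS, hB0B, hc, hli, hsp⟩ := exists_basis_sub (K := K) v B0 S (hB0F.trans hFS) hli0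
  have key : ∃ b ∈ B \ B0, u (v b) ≠ 0 := by
    by_contra! hcon
    obtain ⟨f, hf, hne⟩ := hne
    apply hne
    have hB : ∀ b ∈ B, u (v b) = 0 := by
      intro b hb
      by_cases hb0 : b ∈ B0
      · exact hF b (hB0F hb0)
      · exact hcon b (by simp [hb, hb0])
    have : Submodule.span K (v '' S) ≤ LinearMap.ker u := by
      rw [← hsp, Submodule.span_le]
      rintro _ ⟨b, hb, rfl⟩
      exact hB b hb
    exact this (Submodule.subset_span (Set.mem_image_of_mem _ hf))
  obtain ⟨b0, hb0, hub0⟩ := key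
  refine ⟨(u (v b0))⁻¹, inv_ne_zero hub0, ?_⟩
  set u' : V →ₗ[K] L := (u (v b0))⁻¹ • u with hu'
  set Y := (fun f => u' (v f)) '' (((B \ B0).erase b0 : Finset E) : Set E) with hY
  have h1 : (fun f => (u (v b0))⁻¹ * u (v f)) '' S ⊆ IntermediateField.adjoin K Y := by
    rintro _ ⟨f, hf, rfl⟩
    have : Submodule.span K (v '' S) ≤
        (Subalgebra.toSubmodule (IntermediateField.adjoin K Y).toSubalgebra).comap u' := by
      rw [← hsp, Submodule.span_le]
      rintro _ ⟨b, hb, rfl⟩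
      show u' (v b) ∈ IntermediateField.adjoin K Y
      by_cases hb0' : b ∈ B0
      · have : u' (v b) = 0 := by simp [hu', hF b (hB0F hb0')]
        rw [this]; exact zero_mem _
      by_cases hbb : b = b0
      · have : u' (v b) = 1 := by simp [hu', hbb, hub0]
        rw [this]; exact one_mem _
      · exact IntermediateField.subset_adjoin _ _ ⟨b, by simp_all, rfl⟩
    exact this (Submodule.subset_span (Set.mem_image_of_mem _ hf))
  have h2 := (td_le_of_subset_adjoin h1).trans (td_image_le (K := K) _ _)
  rw [← hc, ← hc0]
  calc _ ≤ (((B \ B0).erase b0).card : ℕ∞) + 1 + B0.card := by gcongr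
    _ = B.card := by
      rw [← Finset.card_sdiff_add_card_eq_card hB0B, ← Finset.card_erase_add_one hb0]
      push_cast; rfl

/-- incidence count -/
lemma td_incidence (v : E → V) (F S : Finset E) (x : E → L) (u : V →ₗ[K] L)
    (hF : ∀ f ∈ F, u (v f) = 0) (hS : ∀ f ∈ S, u (v f) ≠ 0) (hne : S.Nonempty)
    (hk : ∀ φ : V →ₗ[K] L, ∑ f ∈ S, x f * u (v f) * φ (v f) = 0) :
    td K (x '' S) + 1 + rk K v S + rk K v F ≤ S.card + rk K v (F ∪ S) := by
  obtain ⟨f0, hf0⟩ := hne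
  obtain ⟨c, hc, h1⟩ := td_functional (K := K) v F (F ∪ S) Finset.subset_union_left u hF
    ⟨f0, by simp [hf0], hS f0 hf0⟩
  have h2 := td_relation (K := K) v S (fun f => x f * (c * u (v f))) (fun φ => by
    have := congrArg (c * ·) (hk φ)
    simp only [mul_zero, Finset.mul_sum] at this
    rw [← this]
    exact Finset.sum_congr rfl fun _ _ => by ring)
  have h3 : td K (x '' S) ≤ td K ((fun f => x f * (c * u (v f))) '' S) +
      td K ((fun f => c * u (v f)) '' ((F ∪ S : Finset E) : Set E)) := by
    refine le_trans (td_le_of_subset_adjoin ?_) (td_union_le _ _)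
    rintro _ ⟨f, hf, rfl⟩
    have hne : c * u (v f) ≠ 0 := mul_ne_zero hc (hS f hf)
    have : x f = (x f * (c * u (v f))) / (c * u (v f)) := (mul_div_cancel_right₀ _ hne).symm
    rw [this]
    refine div_mem ?_ ?_
    · exact IntermediateField.subset_adjoin _ _ (Or.inl ⟨f, hf, rfl⟩)
    · exact IntermediateField.subset_adjoin _ _ (Or.inr ⟨f, by simp at hf ⊢; exact Or.inr hf, rfl⟩)
  calc _ ≤ (td K ((fun f => x f * (c * u (v f))) '' S) + rk K v S) +
      (td K ((fun f => c * u (v f)) '' ((F ∪ S : Finset E) : Set E)) + 1 + rk K v F) := by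
        refine le_trans (add_le_add_left (add_le_add_left (add_le_add_left h3 _) _) _) ?_
        apply le_of_eq; ring
    _ ≤ _ := add_le_add h2 h1

end rk
end Config

open scoped BigOperators
set_option linter.unusedSectionVars false
namespace Config
section main
variable {K : Type*} [Field K] {V : Type*} [AddCommGroup V] [Module K V] [FiniteDimensional K V]
variable {E : Type*} [DecidableEq E]
variable {L : Type*} [Field L] [Algebra K L]

lemma td_exists_nat (x : E → L) (S : Finset E) : ∃ n : ℕ, td K (x '' S) = n ∧ n ≤ S.card := by
  have h := td_image_le (K := K) x S
  obtain ⟨n, hn⟩ := ENat.ne_top_iff_exists.mp (ne_top_of_le_ne_top (ENat.coe_ne_top _) h)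
  refine ⟨n, hn.symm, ?_⟩
  rw [← hn] at h
  exact_mod_cast h

lemma td_image_union_le (x : E → L) (S T : Finset E) :
    td K (x '' ((S ∪ T : Finset E) : Set E)) ≤ td K (x '' S) + td K (x '' T) := by
  rw [Finset.coe_union, Set.image_union]
  exact td_union_le _ _

lemma lemB (v : E → V) (S : Finset E) (x : E → L) (u : V →ₗ[K] L)
    (hne : ∃ f ∈ S, u (v f) ≠ 0)
    (hk : ∀ φ : V →ₗ[K] L, ∑ f ∈ S, x f * u (v f) * φ (v f) = 0) :
    td K (x '' S) + 1 ≤ S.card := by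
  classical
  set F := S.filter (fun f => u (v f) = 0) with hF
  set T := S.filter (fun f => ¬ u (v f) = 0) with hT
  have hFT : F ∪ T = S := Finset.filter_union_filter_not_eq _ _
  have hcard : F.card + T.card = S.card := Finset.card_filter_add_card_filter_not _
  have h1 := td_incidence (K := K) v F T x u (fun f hf => (Finset.mem_filter.mp hf).2)
    (fun f hf => (Finset.mem_filter.mp hf).2)
    (by obtain ⟨f, hf, h⟩ := hne; exact ⟨f, by simp [hT, hf, h]⟩)
    (fun φ => by
      rw [← hk φ, ← hFT, Finset.sum_union (Finset.disjoint_filter_filter_not _ _ _)]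
      rw [Finset.sum_eq_zero (s := F), zero_add]
      intro f hf; simp [(Finset.mem_filter.mp hf).2])
  have h2 := td_image_union_le (K := K) x F T
  have h3 := rk_union_le (K := K) v F T
  rw [hFT] at h2
  obtain ⟨a, ha, ha'⟩ := td_exists_nat (K := K) x S
  obtain ⟨b, hb, hb'⟩ := td_exists_nat (K := K) x T
  obtain ⟨c, hc, hc'⟩ := td_exists_nat (K := K) x F
  rw [ha, hb, hc] at h2
  rw [hb] at h1
  rw [ha]
  norm_cast at *
  omega

lemma lemC (v : E → V) (S : Finset E) (e : E) (he : e ∈ S) (x : E → L) (u : V →ₗ[K] L)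
    (hconn : Conn K v S) (hue : u (v e) = 0)
    (hne : ∃ f ∈ S, u (v f) ≠ 0)
    (hk : ∀ φ : V →ₗ[K] L, ∑ f ∈ S.erase e, x f * u (v f) * φ (v f) = 0) :
    td K (x '' (S.erase e : Finset E)) + 3 ≤ S.card := by
  classical
  set F := S.filter (fun f => u (v f) = 0) with hF
  set T := S.filter (fun f => ¬ u (v f) = 0) with hT
  have hFT : F ∪ T = S := Finset.filter_union_filter_not_eq _ _
  have hcard : F.card + T.card = S.card := Finset.card_filter_add_card_filter_not _
  have heF : e ∈ F := by simp [hF, he, hue]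
  have heT : e ∉ T := by simp [hT, hue]
  have hTne : T.Nonempty := by obtain ⟨f, hf, h⟩ := hne; exact ⟨f, by simp [hT, hf, h]⟩
  have hFT' : F.erase e ∪ T = S.erase e := by
    rw [← hFT, Finset.erase_union_distrib, Finset.erase_eq_of_notMem heT]
  have hd : Disjoint F T := Finset.disjoint_filter_filter_not _ _ _
  have h1 := td_incidence (K := K) v F T x u (fun f hf => (Finset.mem_filter.mp hf).2)
    (fun f hf => (Finset.mem_filter.mp hf).2) hTne
    (fun φ => by
      rw [← hk φ, ← hFT', Finset.sum_union (hd.mono_left (Finset.erase_subset _ _))]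
      rw [Finset.sum_eq_zero (s := F.erase e), zero_add]
      intro f hf; simp [(Finset.mem_filter.mp (Finset.mem_of_mem_erase hf)).2])
  have h2 := td_image_union_le (K := K) x (F.erase e) T
  have h3 := hconn F T ⟨e, heF⟩ hTne hd hFT
  have h4 := Finset.card_erase_add_one heF
  rw [hFT'] at h2
  rw [hFT] at h1
  obtain ⟨a, ha, ha'⟩ := td_exists_nat (K := K) x (S.erase e)
  obtain ⟨b, hb, hb'⟩ := td_exists_nat (K := K) x T
  obtain ⟨c, hc, hc'⟩ := td_exists_nat (K := K) x (F.erase e)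
  rw [ha, hb, hc] at h2
  rw [hb] at h1
  rw [ha]
  norm_cast at *
  omega

lemma extend_eq (v : E → V) (S : Finset E) (c : E → L)
    (h : ∀ φ : V →ₗ[K] K, ∑ f ∈ S, c f * algebraMap K L (φ (v f)) = 0) (φ : V →ₗ[K] L) :
    ∑ f ∈ S, c f * φ (v f) = 0 := by
  let b := Module.finBasis K V
  have : ∀ f, φ (v f) = ∑ i, algebraMap K L (b.coord i (v f)) * φ (b i) := by
    intro f
    conv_lhs => rw [← b.sum_repr (v f), map_sum]
    simp [Algebra.smul_def]
  simp_rw [this, Finset.mul_sum]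
  rw [Finset.sum_comm]
  refine Finset.sum_eq_zero fun i _ => ?_
  have := congrArg (· * φ (b i)) (h (b.coord i))
  simp only [Finset.sum_mul, zero_mul] at this
  rw [← this]
  exact Finset.sum_congr rfl fun _ _ => by ring

lemma transc (v : E → V) (S : Finset E) (e : E) (he : e ∈ S) (x : E → L) (u : V →ₗ[K] L)
    (hk : ∀ φ : V →ₗ[K] L, ∑ f ∈ S, x f * u (v f) * φ (v f) = 0)
    (hx : x e ∉ IntermediateField.adjoin K (x '' (S.erase e : Finset E))) : u (v e) = 0 := by
  by_contra hu
  set F := IntermediateField.adjoin K (x '' (S.erase e : Finset E)) with hF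
  have hxe : x e ≠ 0 := fun h => hx (h ▸ zero_mem _)
  obtain ⟨ρ, hρ⟩ := LinearMap.exists_leftInverse_of_injective (Algebra.linearMap F L)
    (LinearMap.ker_eq_bot.mpr (algebraMap F L).injective)
  have hρ' : ∀ a : F, ρ (algebraMap F L a) = a := fun a => by
    simpa using congrArg (fun g => g a) hρ
  set u1 : V →ₗ[K] L := (- (x e * u (v e)))⁻¹ • u with hu1
  have hk1 : ∀ φ : V →ₗ[K] L, ∑ f ∈ S.erase e, x f * u1 (v f) * φ (v f) = φ (v e) := by
    intro φ
    have h := hk φ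
    rw [← Finset.add_sum_erase _ _ he] at h
    have h' : ∑ f ∈ S.erase e, x f * u1 (v f) * φ (v f) =
        (- (x e * u (v e)))⁻¹ * ∑ f ∈ S.erase e, x f * u (v f) * φ (v f) := by
      rw [Finset.mul_sum]
      refine Finset.sum_congr rfl fun _ _ => ?_
      simp only [hu1, LinearMap.smul_apply, smul_eq_mul]; ring
    rw [h', eq_neg_of_add_eq_zero_right h]
    field_simp
  -- retract
  set u2 : V →ₗ[K] L := (Algebra.linearMap F L).restrictScalars K ∘ₗ (ρ.restrictScalars K) ∘ₗ u1
    with hu2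
  have hk2 : ∀ φ : V →ₗ[K] L, ∑ f ∈ S, (if f = e then -1 else x f * u2 (v f)) * φ (v f) = 0 := by
    refine extend_eq v S _ fun φ => ?_
    have h := hk1 ((Algebra.linearMap K L).comp φ)
    rw [← Finset.add_sum_erase _ _ he, if_pos rfl]
    rw [Finset.sum_congr rfl (g := fun f => algebraMap F L (ρ (x f * u1 (v f) * algebraMap K L (φ (v f)))))]
    · rw [← map_sum, ← map_sum]
      simp only [LinearMap.comp_apply, Algebra.linearMap_apply] at h
      rw [h, IsScalarTower.algebraMap_apply K F L, hρ']
      simp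
    · intro f hf
      have hne : f ≠ e := (Finset.mem_erase.mp hf).1
      rw [if_neg hne]
      have hxf : x f ∈ F := IntermediateField.subset_adjoin _ _ ⟨f, hf, rfl⟩
      have : x f * u1 (v f) * algebraMap K L (φ (v f)) =
        ((⟨x f, hxf⟩ : F) * algebraMap K F (φ (v f))) • u1 (v f) := by
          rw [Algebra.smul_def, map_mul, ← IsScalarTower.algebraMap_apply]
          show _ = x f * _ * _
          ring
      rw [this, map_smul, smul_eq_mul, map_mul, map_mul, ← IsScalarTower.algebraMap_apply]
      simp only [hu2, LinearMap.comp_apply, LinearMap.restrictScalars_apply,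
        Algebra.linearMap_apply]
      show _ = x f * _ * _
      ring
  have h1 := hk1 u2
  have h2 := hk2 u1
  rw [← Finset.add_sum_erase _ _ he, if_pos rfl,
    Finset.sum_congr rfl (g := fun f => x f * u1 (v f) * u2 (v f)), h1] at h2
  · have h3 : u1 (v e) = u2 (v e) := by linear_combination -h2
    have h4 : u1 (v e) = - (x e)⁻¹ := by
      simp only [hu1, LinearMap.smul_apply, smul_eq_mul]; field_simp
    have h5 : u2 (v e) ∈ F := (ρ (u1 (v e))).2
    apply hx
    rw [← h3, h4] at h5
    simpa using inv_mem (neg_mem h5)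
  · intro f hf
    have hne : f ≠ e := (Finset.mem_erase.mp hf).1
    rw [if_neg hne]; ring

end main
end Config

open scoped BigOperators
set_option linter.unusedSectionVars false
namespace Config
section main2
variable {K : Type*} [Field K] {V : Type*} [AddCommGroup V] [Module K V] [FiniteDimensional K V]
variable {E : Type*} [DecidableEq E]
variable {L : Type*} [Field L] [Algebra K L]

lemma rk_update_of_notMem (v : E → V) (e : E) (a : V) (S : Finset E) (h : e ∉ S) :
    rk K (Function.update v e a) S = rk K v S := by
  have : Function.update v e a '' S = v '' S := by
    refine Set.image_congr fun f hf => ?_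
    rw [Function.update_of_ne]
    rintro rfl; exact h hf
  unfold rk
  rw [this]

lemma sepConn (v : E → V) (A B : Finset E) (e : E) (hdis : Disjoint A B) (heA : e ∉ A) (heB : e ∉ B)
    (a b : V) (hab : v e = a + b) (ha : a ∈ Submodule.span K (v '' A))
    (hb : b ∈ Submodule.span K (v '' B)) (hsep : rk K v A + rk K v B ≤ rk K v (A ∪ B))
    (hconn : Conn K v (insert e (A ∪ B))) : Conn K (Function.update v e a) (insert e A) := by
  have key : ∀ X Y : Finset E, e ∈ X → Y.Nonempty → Disjoint X Y → X ∪ Y = insert e A →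
      rk K (Function.update v e a) (insert e A) <
      rk K (Function.update v e a) X + rk K (Function.update v e a) Y := by
    intro X Y heX hY hXY hU
    have heY : e ∉ Y := Finset.disjoint_left.mp hXY heX
    have hYA : Y ⊆ A := fun y hy => by
      have : y ∈ insert e A := hU ▸ Finset.mem_union_right _ hy
      rcases Finset.mem_insert.mp this with rfl | h
      · exact absurd hy heY
      · exact h
    have h1 : rk K (Function.update v e a) (insert e A) = rk K v A := by
      rw [← rk_update_of_notMem (K := K) v e a A heA]
      unfold rk
      rw [Finset.coe_insert, Set.image_insert_eq, Submodule.span_insert_eq_span]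
      rw [Function.update_self]
      convert ha using 2
      refine congrArg _ (Set.image_congr fun f hf => ?_)
      rw [Function.update_of_ne]
      rintro rfl; exact heA hf
    have h2 := hconn (X ∪ B) Y ⟨e, by simp [heX]⟩ hY
      (Finset.disjoint_union_left.mpr ⟨hXY, (hdis.mono_left hYA).symm⟩)
      (by rw [Finset.union_right_comm, hU, Finset.insert_union])
    have h3 : rk K v (A ∪ B) ≤ rk K v (insert e (A ∪ B)) :=
      Submodule.finrank_mono (Submodule.span_mono (Set.image_mono (by simp)))
    have h4 : rk K v (X ∪ B) ≤ rk K (Function.update v e a) X + rk K v B := by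
      refine le_trans (Submodule.finrank_mono ?_) (Submodule.finrank_add_le_finrank_add_finrank _ _)
      rw [Submodule.span_le]
      rintro _ ⟨f, hf, rfl⟩
      rw [Finset.coe_union] at hf
      rcases hf with hf | hf
      · by_cases hfe : f = e
        · subst hfe
          rw [hab]
          refine Submodule.add_mem_sup (Submodule.subset_span ⟨f, hf, ?_⟩) hb
          simp
        · refine Submodule.mem_sup_left (Submodule.subset_span ⟨f, hf, ?_⟩)
          rw [Function.update_of_ne hfe]
      · exact Submodule.mem_sup_right (Submodule.subset_span ⟨f, hf, rfl⟩)
    rw [rk_update_of_notMem v e a Y heY, h1]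
    omega
  intro X Y hX hY hXY hU
  have : e ∈ X ∪ Y := hU ▸ Finset.mem_insert_self _ _
  rcases Finset.mem_union.mp this with h | h
  · exact key X Y h hY hXY hU
  · rw [add_comm]
    exact key Y X h hX hXY.symm (by rw [Finset.union_comm, hU])

/-- the bilinear form -/
def IsKer (v : E → V) (S : Finset E) (x : E → L) (u : V →ₗ[K] L) : Prop :=
  ∀ φ : V →ₗ[K] L, ∑ f ∈ S, x f * u (v f) * φ (v f) = 0

lemma IsKer.comb {v : E → V} {S : Finset E} {x : E → L} {u1 u2 : V →ₗ[K] L}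
    (h1 : IsKer v S x u1) (h2 : IsKer v S x u2) (a b : L) : IsKer v S x (a • u1 + b • u2) := by
  intro φ
  have : ∑ f ∈ S, x f * (a • u1 + b • u2) (v f) * φ (v f) =
    a * (∑ f ∈ S, x f * u1 (v f) * φ (v f)) + b * (∑ f ∈ S, x f * u2 (v f) * φ (v f)) := by
    rw [Finset.mul_sum, Finset.mul_sum, ← Finset.sum_add_distrib]
    refine Finset.sum_congr rfl fun _ _ => ?_
    simp only [LinearMap.add_apply, LinearMap.smul_apply, smul_eq_mul]; ring
  rw [this, h1 φ, h2 φ]; ring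

/-- independence of the restrictions -/
def Ind2 (v : E → V) (S : Finset E) (u1 u2 : V →ₗ[K] L) : Prop :=
  ∀ a b : L, (∀ f ∈ S, (a • u1 + b • u2) (v f) = 0) → a = 0 ∧ b = 0

lemma exists_comb_zero (u1 u2 : V →ₗ[K] L) (z : V) : ∃ a b : L, ¬ (a = 0 ∧ b = 0) ∧
    (a • u1 + b • u2) z = 0 := by
  by_cases h : u1 z = 0
  · exact ⟨1, 0, by simp, by simp [h]⟩
  · exact ⟨u2 z, - u1 z, by simp [h], by simp; ring⟩

lemma IsKer.sub {v : E → V} {A B : Finset E} {x : E → L} {u : V →ₗ[K] L}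
    (hdis : Disjoint A B) (π : V →ₗ[K] V) (hA : ∀ f ∈ A, π (v f) = v f) (hB : ∀ f ∈ B, π (v f) = 0)
    (h : IsKer v (A ∪ B) x u) : IsKer v A x u := by
  intro φ
  have := h (φ ∘ₗ π)
  rw [Finset.sum_union hdis, Finset.sum_eq_zero (s := B), add_zero] at this
  · rw [← this]
    refine Finset.sum_congr rfl fun f hf => ?_
    simp [hA f hf]
  · intro f hf; simp [hB f hf]

lemma IsKer.update {v : E → V} {A : Finset E} {x : E → L} {u : V →ₗ[K] L} {e : E} (he : e ∉ A)
    (a : V) (h : IsKer v A x u) : IsKer (Function.update v e a) A x u := by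
  intro φ
  rw [← h φ]
  refine Finset.sum_congr rfl fun f hf => ?_
  rw [Function.update_of_ne]
  rintro rfl; exact he hf

/-- the separated case with a combination vanishing on `A`. -/
lemma sepcase (v : E → V) (A B : Finset E) (e : E) (x : E → L) (u1 u2 : V →ₗ[K] L)
    (hdis : Disjoint A B) (heA : e ∉ A) (heB : e ∉ B)
    (hxe : td K (x '' B) + 1 ≤ td K (x '' (insert e B : Finset E)))
    (a b : V) (hab : v e = a + b) (ha : a ∈ Submodule.span K (v '' A))
    (hconnB : Conn K (Function.update v e b) (insert e B))
    (hA1 : IsKer v A x u1) (hA2 : IsKer v A x u2)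
    (hB1 : IsKer v B x u1) (hB2 : IsKer v B x u2)
    (he1 : u1 (v e) = 0) (he2 : u2 (v e) = 0)
    (hind : Ind2 v (A ∪ B) u1 u2)
    (IH : Conn K (Function.update v e b) (insert e B) →
      IsKer (Function.update v e b) (insert e B) x u1 →
      IsKer (Function.update v e b) (insert e B) x u2 →
      Ind2 (Function.update v e b) (insert e B) u1 u2 →
      td K (x '' (insert e B : Finset E)) + 3 ≤ (insert e B).card)
    (s t : L) (hst : ¬ (s = 0 ∧ t = 0)) (hN : ∀ f ∈ A, (s • u1 + t • u2) (v f) = 0) :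
    td K (x '' (A ∪ B : Finset E)) + 4 ≤ A.card + B.card + 1 ∨
    td K (x '' (A ∪ B : Finset E)) + 1 + 3 ≤ A.card + B.card + 1 := by
  have hvan : ∀ u : V →ₗ[K] L, (∀ f ∈ A, u (v f) = 0) → u a = 0 := by
    intro u hu
    have : Submodule.span K (v '' A) ≤ LinearMap.ker u := by
      rw [Submodule.span_le]
      rintro _ ⟨f, hf, rfl⟩
      exact hu f hf
    exact this ha
  have hub : ∀ u : V →ₗ[K] L, u (v e) = 0 → (∀ f ∈ A, u (v f) = 0) → u b = 0 := by
    intro u hu hA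
    have := hvan u hA
    rw [hab, map_add, this, zero_add] at hu
    exact hu
  have hne_upd : ∀ f ∈ B, f ≠ e := fun f hf => by rintro rfl; exact heB hf
  have h2 := td_image_union_le (K := K) x A B
  obtain ⟨na, hna, hna'⟩ := td_exists_nat (K := K) x (A ∪ B)
  obtain ⟨nb, hnb, hnb'⟩ := td_exists_nat (K := K) x A
  obtain ⟨nc, hnc, hnc'⟩ := td_exists_nat (K := K) x B
  obtain ⟨nd, hnd, hnd'⟩ := td_exists_nat (K := K) x (insert e B)
  have hcB : (insert e B).card = B.card + 1 := Finset.card_insert_of_notMem heB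
  by_cases hall : ∃ s' t' : L, ∃ f ∈ A, (s' • u1 + t' • u2) (v f) ≠ 0
  · left
    obtain ⟨s', t', f, hf, hne⟩ := hall
    have hBl := lemB v A x (s' • u1 + t' • u2) ⟨f, hf, hne⟩ (hA1.comb hA2 s' t')
    have hC := lemC (Function.update v e b) (insert e B) e (Finset.mem_insert_self _ _) x
      (s • u1 + t • u2) hconnB (by
        rw [Function.update_self]
        exact hub _ (by simp [he1, he2]) hN) (by
        by_contra! hcon
        refine hst (hind s t fun f hf => ?_)
        rcases Finset.mem_union.mp hf with h | h
        · exact hN f h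
        · have := hcon f (Finset.mem_insert_of_mem h)
          rwa [Function.update_of_ne (hne_upd f h)] at this)
      (by
        rw [Finset.erase_insert heB]
        exact (hB1.comb hB2 s t).update heB b)
    rw [Finset.erase_insert heB, hcB, hnc] at hC
    rw [hna, hnb, hnc] at h2
    rw [hnb] at hBl
    rw [hna]
    norm_cast at *
    omega
  · right
    push Not at hall
    have h1A : ∀ f ∈ A, u1 (v f) = 0 := fun f hf => by simpa using hall 1 0 f hf
    have h2A : ∀ f ∈ A, u2 (v f) = 0 := fun f hf => by simpa using hall 0 1 f hf
    have hk : ∀ u : V →ₗ[K] L, u b = 0 → IsKer v B x u →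
        IsKer (Function.update v e b) (insert e B) x u := by
      intro u hu h φ
      rw [Finset.sum_insert heB, h.update heB b φ, Function.update_self, hu]
      ring
    have := IH hconnB (hk u1 (hub u1 he1 h1A) hB1) (hk u2 (hub u2 he2 h2A) hB2) (by
      intro s t hst
      refine hind s t fun f hf => ?_
      rcases Finset.mem_union.mp hf with h | h
      · simp [h1A f h, h2A f h]
      · have := hst f (Finset.mem_insert_of_mem h)
        rwa [Function.update_of_ne (hne_upd f h)] at this)
    rw [hcB, hnd] at this
    rw [hna, hnb, hnc] at h2
    rw [hnc, hnd] at hxe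
    rw [hna]
    norm_cast at *
    omega

theorem mainP (n : ℕ) : ∀ (v : E → V) (S : Finset E) (x : E → L) (u1 u2 : V →ₗ[K] L),
    S.card = n → Conn K v S → IsKer v S x u1 → IsKer v S x u2 → Ind2 v S u1 u2 →
    td K (x '' S) + 3 ≤ S.card := by
  induction n using Nat.strong_induction_on with
  | _ n IH =>
  intro v S x u1 u2 hn hconn h1 h2 hind
  have hSne : S.Nonempty := by
    rw [Finset.nonempty_iff_ne_empty]
    rintro rfl
    simpa using (hind 1 0 (by simp)).1
  obtain ⟨e, he⟩ := hSne
  have himg : x '' S = insert (x e) (x '' (S.erase e : Finset E)) := by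
    rw [← Set.image_insert_eq, ← Finset.coe_insert, Finset.insert_erase he]
  have hcard := Finset.card_erase_add_one he
  obtain ⟨na, hna, hna'⟩ := td_exists_nat (K := K) x S
  obtain ⟨nb, hnb, hnb'⟩ := td_exists_nat (K := K) x (S.erase e)
  rcases td_insert_dichotomy (K := K) (x e) (x '' (S.erase e : Finset E)) with hal | ⟨hna_e, htr⟩
  · -- algebraic case
    obtain ⟨s, t, hst, h0⟩ := exists_comb_zero u1 u2 (v e)
    have hC := lemC v S e he x (s • u1 + t • u2) hconn h0 (by
      by_contra! hcon
      exact hst (hind s t hcon)) (by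
      intro φ
      have := (h1.comb h2 s t) φ
      rw [← Finset.add_sum_erase _ _ he, h0] at this
      simpa using this)
    rw [himg]
    exact le_trans (by gcongr) hC
  · have he1 := transc v S e he x u1 h1 hna_e
    have he2 := transc v S e he x u2 h2 hna_e
    have hk : ∀ u : V →ₗ[K] L, u (v e) = 0 → IsKer v S x u → IsKer v (S.erase e) x u := by
      intro u hu h φ
      have := h φ
      rw [← Finset.add_sum_erase _ _ he, hu] at this
      simpa using this
    have h1' := hk u1 he1 h1
    have h2' := hk u2 he2 h2
    have hind' : Ind2 v (S.erase e) u1 u2 := by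
      intro s t hst
      refine hind s t fun f hf => ?_
      by_cases hfe : f = e
      · subst hfe; simp [he1, he2]
      · exact hst f (by simp [hf, hfe])
    have htot := td_insert_le (K := K) (x e) (x '' (S.erase e : Finset E))
    rw [← himg, hna, hnb] at htot
    suffices hsuff : td K (x '' (S.erase e : Finset E)) + 4 ≤ S.card by
      rw [hnb] at hsuff
      rw [hna]
      norm_cast at *
      omega
    by_cases hc : Conn K v (S.erase e)
    · have := IH (S.erase e).card (by omega) v (S.erase e) x u1 u2 rfl hc h1' h2' hind'
      rw [hnb] at this ⊢
      norm_cast at *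
      omega
    · unfold Conn at hc
      push Not at hc
      obtain ⟨A, B, hA, hB, hdis, hAB, hsep⟩ := hc
      have heAB : e ∉ A ∪ B := by rw [hAB]; simp
      have heA : e ∉ A := fun h => heAB (Finset.mem_union_left _ h)
      have heB : e ∉ B := fun h => heAB (Finset.mem_union_right _ h)
      have hS : insert e (A ∪ B) = S := by rw [hAB, Finset.insert_erase he]
      -- v e in the span
      have hspan_union : Submodule.span K (v '' ((A ∪ B : Finset E) : Set E)) =
          Submodule.span K (v '' A) ⊔ Submodule.span K (v '' B) := by
        rw [Finset.coe_union, Set.image_union, Submodule.span_union]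
      have hve : v e ∈ Submodule.span K (v '' A) ⊔ Submodule.span K (v '' B) := by
        rw [← hspan_union]
        by_contra hcon
        have h := hconn {e} (A ∪ B) ⟨e, by simp⟩ (hA.mono Finset.subset_union_left)
          (by simpa using heAB) (by rw [← hS]; rfl)
        have hlt : rk K v (A ∪ B) < rk K v S := by
          refine Submodule.finrank_lt_finrank_of_lt (lt_of_le_of_ne
            (Submodule.span_mono (Set.image_mono (by rw [← hS]; simp))) ?_)
          intro heq
          apply hcon
          rw [heq]
          exact Submodule.subset_span ⟨e, he, rfl⟩
        have : rk K v {e} ≤ 1 := by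
          have hs : v '' (({e} : Finset E) : Set E) = {v e} := by simp
          unfold rk
          rw [hs]
          exact (finrank_span_le_card (R := K) ({v e} : Set V)).trans (by simp)
        omega
      obtain ⟨a, ha, b, hb, hab⟩ := Submodule.mem_sup.mp hve
      -- the projection
      have hinf : Disjoint (Submodule.span K (v '' A)) (Submodule.span K (v '' B)) := by
        rw [disjoint_iff, ← Submodule.finrank_eq_zero (R := K)]
        have := Submodule.finrank_sup_add_finrank_inf_eq (Submodule.span K (v '' A))
          (Submodule.span K (v '' B))
        rw [← hspan_union] at this
        rw [← hAB] at hsep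
        unfold rk at hsep
        omega
      have proj : ∀ P Q : Submodule K V, Disjoint P Q →
          ∃ π : V →ₗ[K] V, (∀ p ∈ P, π p = p) ∧ ∀ q ∈ Q, π q = 0 := by
        intro P Q hPQ
        obtain ⟨Q', hQQ', hPQ'⟩ := hPQ.symm.exists_isCompl
        refine ⟨P.subtype ∘ₗ P.projectionOnto Q' hPQ'.symm, fun p hp => ?_, fun q hq => ?_⟩
        · rw [LinearMap.comp_apply, Submodule.projectionOnto_apply_left hPQ'.symm ⟨p, hp⟩]; rfl
        · rw [LinearMap.comp_apply, Submodule.projectionOnto_apply_right hPQ'.symm ⟨q, hQQ' hq⟩]; rfl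
      have hkA : ∀ u : V →ₗ[K] L, IsKer v (S.erase e) x u → IsKer v A x u ∧ IsKer v B x u := by
        intro u hu
        obtain ⟨π, hπ1, hπ2⟩ := proj _ _ hinf
        obtain ⟨π', hπ'1, hπ'2⟩ := proj _ _ hinf.symm
        have hsub : ∀ T : Finset E, ∀ f ∈ T, v f ∈ Submodule.span K (v '' T) :=
          fun T f hf => Submodule.subset_span ⟨f, hf, rfl⟩
        rw [← hAB] at hu
        refine ⟨hu.sub hdis π (fun f hf => hπ1 _ (hsub _ f hf)) (fun f hf => hπ2 _ (hsub _ f hf)), ?_⟩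
        rw [Finset.union_comm] at hu
        exact hu.sub hdis.symm π' (fun f hf => hπ'1 _ (hsub _ f hf)) (fun f hf => hπ'2 _ (hsub _ f hf))
      have hA1 := (hkA u1 h1').1
      have hA2 := (hkA u2 h2').1
      have hB1 := (hkA u1 h1').2
      have hB2 := (hkA u2 h2').2
      rw [← hS] at hconn
      rw [← hAB] at hsep hind' 
      have hcAB : A.card + B.card + 1 = S.card := by
        rw [← hcard, ← hAB, Finset.card_union_of_disjoint hdis]
      have hconnA := sepConn v A B e hdis heA heB a b hab.symm ha hb hsep hconn
      have hconnB := sepConn v B A e hdis.symm heB heA b a (by rw [add_comm, hab]) hb ha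
        (by rwa [add_comm, Finset.union_comm]) (by rwa [Finset.union_comm])
      have htr' : ∀ T : Finset E, T ⊆ A ∪ B →
          td K (x '' T) + 1 ≤ td K (x '' (insert e T : Finset E)) := by
        intro T hT
        rw [Finset.coe_insert, Set.image_insert_eq]
        refine htr _ (Set.image_mono ?_)
        rw [← hAB]; exact_mod_cast hT
      have hAc := hA.card_pos
      have hBc := hB.card_pos
      rw [← hAB] at hnb
      by_cases hNA : ∃ s t : L, ¬ (s = 0 ∧ t = 0) ∧ ∀ f ∈ A, (s • u1 + t • u2) (v f) = 0
      · obtain ⟨s, t, hst, hN⟩ := hNA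
        have := sepcase v A B e x u1 u2 hdis heA heB (htr' B Finset.subset_union_right) a b hab.symm
          ha hconnB hA1 hA2 hB1 hB2 he1 he2 hind'
          (IH (insert e B).card (by rw [Finset.card_insert_of_notMem heB]; omega) _ _ x u1 u2 rfl)
          s t hst hN
        rw [← hAB]
        rw [hnb] at this ⊢
        norm_cast at *
        omega
      by_cases hNB : ∃ s t : L, ¬ (s = 0 ∧ t = 0) ∧ ∀ f ∈ B, (s • u1 + t • u2) (v f) = 0
      · obtain ⟨s, t, hst, hN⟩ := hNB
        have := sepcase v B A e x u1 u2 hdis.symm heB heA (htr' A Finset.subset_union_left) b a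
          (by rw [add_comm, hab])
          hb hconnA hB1 hB2 hA1 hA2 he1 he2 (by rwa [Finset.union_comm])
          (IH (insert e A).card (by rw [Finset.card_insert_of_notMem heA]; omega) _ _ x u1 u2 rfl)
          s t hst hN
        rw [← hAB]
        rw [Finset.union_comm, hnb] at this
        rw [hnb]
        norm_cast at *
        omega
      -- both independent
      push Not at hNA hNB
      obtain ⟨s, t, hst, h0⟩ := exists_comb_zero u1 u2 a
      obtain ⟨f, hf, hne⟩ := hNA s t (by tauto)
      have hC := lemC (Function.update v e a) (insert e A) e (Finset.mem_insert_self _ _) x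
        (s • u1 + t • u2) hconnA (by rwa [Function.update_self])
        ⟨f, Finset.mem_insert_of_mem hf, by
          rwa [Function.update_of_ne (by rintro rfl; exact heA hf)]⟩
        (by
          rw [Finset.erase_insert heA]
          exact (hA1.comb hA2 s t).update heA a)
      obtain ⟨g, hg, hgne⟩ := hNB 1 0 (by simp)
      have hBl := lemB v B x ((1:L) • u1 + (0:L) • u2) ⟨g, hg, hgne⟩ (hB1.comb hB2 1 0)
      have hun := td_image_union_le (K := K) x A B
      obtain ⟨nc, hnc, hnc'⟩ := td_exists_nat (K := K) x A
      obtain ⟨nd, hnd, hnd'⟩ := td_exists_nat (K := K) x B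
      rw [Finset.erase_insert heA, Finset.card_insert_of_notMem heA, hnc] at hC
      rw [hnd] at hBl
      rw [hnb, hnc, hnd] at hun
      rw [← hAB, hnb]
      norm_cast at *
      omega

end main2
end Config

open scoped BigOperators
set_option linter.unusedSectionVars false
namespace Config
variable {K : Type} [Field K] {E : Type} [Fintype E] [DecidableEq E]

lemma two_ker {L : Type*} [Field L] {r : ℕ} (M : Matrix (Fin r) (Fin r) L) (hr : 0 < r)
    (hs : M.transpose = M) (hadj : M.adjugate = 0) :
    ∃ u1 u2 : Fin r → L, M.mulVec u1 = 0 ∧ M.mulVec u2 = 0 ∧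
      ∀ a b : L, a • u1 + b • u2 = 0 → a = 0 ∧ b = 0 := by
  have hdet : M.det = 0 := by
    have := M.mul_adjugate
    rw [hadj, mul_zero] at this
    have h := congrFun (congrFun this ⟨0, hr⟩) ⟨0, hr⟩
    simpa using h.symm
  obtain ⟨u1, hu1, h1⟩ := Matrix.exists_mulVec_eq_zero_iff.mpr hdet
  obtain ⟨k, hk⟩ := Function.ne_iff.mp hu1
  have hk : u1 k ≠ 0 := hk
  have hdk : (M.updateRow k (Pi.single k 1)).det = 0 := by
    rw [← Matrix.adjugate_apply, hadj]; rfl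
  obtain ⟨u2, hu2, h2⟩ := Matrix.exists_mulVec_eq_zero_iff.mpr hdk
  have h2k : u2 k = 0 := by
    have := congrFun h2 k
    simpa [Matrix.mulVec, Matrix.updateRow_self] using this
  have h2i : ∀ i, i ≠ k → M.mulVec u2 i = 0 := by
    intro i hi
    have := congrFun h2 i
    simpa [Matrix.mulVec, Matrix.updateRow_ne hi] using this
  have h2' : M.mulVec u2 = 0 := by
    funext i
    by_cases hi : i = k
    · subst hi
      have h3 : dotProduct u1 (M.mulVec u2) = 0 := by
        rw [Matrix.dotProduct_mulVec, ← Matrix.mulVec_transpose, hs, h1, zero_dotProduct]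
      unfold dotProduct at h3
      rw [Finset.sum_eq_single i] at h3
      · simpa [hk] using h3
      · intro b _ hb; rw [h2i b hb, mul_zero]
      · simp
    · exact h2i i hi
  refine ⟨u1, u2, h1, h2', fun a b hab => ?_⟩
  have ha : a = 0 := by
    have := congrFun hab k
    simpa [h2k, hk] using this
  subst ha
  refine ⟨rfl, ?_⟩
  simpa [hu2] using hab

lemma span_cols {r : ℕ} (w : Fin r → E → K) (hw : LinearIndependent K w) :
    Submodule.span K (Set.range fun (e : E) (i : Fin r) => w i e) = ⊤ := by
  by_contra hne
  obtain ⟨φ, hφ, hle⟩ := Submodule.exists_le_ker_of_lt_top _ (lt_top_iff_ne_top.mpr hne)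
  apply hφ
  have h0 : ∀ i, φ (Pi.single i 1) = 0 := by
    have := Fintype.linearIndependent_iff.mp hw (fun i => φ (Pi.single i 1)) (by
      funext e
      have h := hle (Submodule.subset_span ⟨e, rfl⟩)
      rw [LinearMap.mem_ker, LinearMap.pi_apply_eq_sum_univ] at h
      simp only [Finset.sum_apply, Pi.smul_apply, smul_eq_mul, Pi.zero_apply]
      rw [← h]
      refine Finset.sum_congr rfl fun i _ => ?_
      rw [smul_eq_mul, mul_comm]
      congr 2
      funext j
      simp [Pi.single_apply, eq_comm])
    exact this
  refine LinearMap.pi_ext' fun i => ?_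
  ext
  simp [h0]

lemma td_bound {L : Type*} [Field L] [Algebra K L] {r : ℕ} (w : Fin r → E → K)
    (hw : LinearIndependent K w) (hr : 0 < r)
    (hconn : Conn K (fun (e : E) (i : Fin r) => w i e) Finset.univ) (x : E → L)
    (hadj : (Matrix.of fun i j : Fin r =>
      ∑ e, algebraMap K L (w i e * w j e) * x e).adjugate = 0) :
    td K (Set.range x) + 3 ≤ Fintype.card E := by
  obtain ⟨u1, u2, h1, h2, hind⟩ := two_ker _ hr (by
    ext i j; simp [mul_comm]) hadj
  let fn : (Fin r → L) → ((Fin r → K) →ₗ[K] L) := fun u =>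
    { toFun := fun z => ∑ i, u i * algebraMap K L (z i)
      map_add' := fun a b => by simp [mul_add, Finset.sum_add_distrib]
      map_smul' := fun c a => by
        simp only [Pi.smul_apply, smul_eq_mul, map_mul, RingHom.id_apply, Algebra.smul_def,
          Finset.mul_sum]
        exact Finset.sum_congr rfl fun _ _ => by ring }
  have hfn : ∀ u z, fn u z = ∑ i, u i * algebraMap K L (z i) := fun _ _ => rfl
  have hker : ∀ u, (Matrix.of fun i j : Fin r =>
      ∑ e, algebraMap K L (w i e * w j e) * x e).mulVec u = 0 →
      IsKer (fun (e : E) (i : Fin r) => w i e) Finset.univ x (fn u) := by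
    intro u hu
    intro φ
    refine extend_eq (fun (e : E) (i : Fin r) => w i e) Finset.univ
      (fun f => x f * fn u (fun i => w i f)) (fun φ => ?_) φ
    have hφ : ∀ z : Fin r → K, algebraMap K L (φ z) =
        ∑ i, algebraMap K L (φ (Pi.single i 1)) * algebraMap K L (z i) := by
      intro z
      rw [LinearMap.pi_apply_eq_sum_univ φ z, map_sum]
      refine Finset.sum_congr rfl fun i _ => ?_
      rw [smul_eq_mul, map_mul, mul_comm]
      congr 3
      funext j
      simp [Pi.single_apply, eq_comm]
    have : ∀ i, ∑ f, x f * fn u (fun i => w i f) * algebraMap K L (w i f) = 0 := by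
      intro i
      have := congrFun hu i
      simp only [Matrix.mulVec, dotProduct, Matrix.of_apply, Pi.zero_apply, Finset.sum_mul] at this
      rw [Finset.sum_comm] at this
      rw [← this]
      refine Finset.sum_congr rfl fun f _ => ?_
      rw [hfn, Finset.mul_sum, Finset.sum_mul]
      refine Finset.sum_congr rfl fun j _ => ?_
      rw [map_mul]; ring
    rw [Finset.sum_congr rfl fun f _ => by rw [hφ (fun i => w i f), Finset.mul_sum]]
    rw [Finset.sum_comm]
    refine Finset.sum_eq_zero fun i _ => ?_
    have h := congrArg (algebraMap K L (φ (Pi.single i 1)) * ·) (this i)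
    simp only [mul_zero, Finset.mul_sum] at h
    rw [← h]
    exact Finset.sum_congr rfl fun _ _ => by ring
  have := mainP (K := K) (Finset.univ : Finset E).card (fun (e : E) (i : Fin r) => w i e) Finset.univ x
    (fn u1) (fn u2) rfl hconn (hker u1 h1) (hker u2 h2) (by
      intro a b hab
      apply hind
      have hz : (a • fn u1 + b • fn u2) = 0 := by
        refine LinearMap.ext_on_range (span_cols w hw) fun e => ?_
        exact hab e (Finset.mem_univ e)
      funext i
      have := congrArg (fun g => g (Pi.single i 1)) hz
      simpa [hfn, Pi.single_apply, apply_ite (algebraMap K L)] using this)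
  simpa [Set.image_univ] using this

lemma conn_of_connected (W : Submodule K (E → K)) {r : ℕ} (w : Fin r → E → K)
    (hw : IsBasisOf w W) (hconn : Connected W) :
    Conn K (fun (e : E) (i : Fin r) => w i e) Finset.univ := by
  set v : E → Fin r → K := fun (e : E) (i : Fin r) => w i e with hv
  have hindep : ∀ S : Finset E, Indep W S ↔ LinearIndepOn K v S := by
    intro S
    -- restrict functionals along the basis
    let T : Module.Dual K W →ₗ[K] (Fin r → K) := LinearMap.pi fun i =>
      LinearMap.applyₗ (⟨w i, by rw [← hw.2]; exact Submodule.subset_span ⟨i, rfl⟩⟩ : W)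
    have hT : ∀ e, T (coordFun W e) = v e := fun e => rfl
    have hTinj : LinearMap.ker T = ⊥ := by
      rw [LinearMap.ker_eq_bot']
      intro φ hφ
      ext ⟨z, hz⟩
      have hz' := hz
      rw [← hw.2] at hz'
      induction hz' using Submodule.span_induction with
      | mem x hx => obtain ⟨i, rfl⟩ := hx; exact congrFun hφ i
      | zero => exact map_zero φ
      | add a b ha hb iha ihb =>
        rw [hw.2] at ha hb
        have := φ.map_add ⟨a, ha⟩ ⟨b, hb⟩
        rw [iha ha, ihb hb] at this
        simpa using this
      | smul c a ha iha =>
        rw [hw.2] at ha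
        have := φ.map_smul c ⟨a, ha⟩
        rw [iha ha] at this
        simpa using this
    have := LinearMap.linearIndependent_iff T (v := fun e : S => coordFun W e) hTinj
    exact this.symm
  intro A B hA hB hdis hU
  obtain ⟨e, he⟩ := hA
  obtain ⟨f, hf⟩ := hB
  obtain ⟨C, ⟨hdep, hmin⟩, heC, hfC⟩ := hconn.2 e f (by
    rintro rfl; exact Finset.disjoint_left.mp hdis he hf)
  rw [hindep] at hdep
  have hdep' : ∃ c : E → K, (∑ g ∈ C, c g • v g = 0) ∧ ∃ g ∈ C, c g ≠ 0 := by
    rw [linearIndepOn_finset_iff] at hdep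
    push Not at hdep
    exact hdep
  obtain ⟨c, hc, g, hg, hgne⟩ := hdep'
  have hall : ∀ h ∈ C, c h ≠ 0 := by
    intro h hh h0
    have hi := (hindep _).mp (hmin (C.erase h) (Finset.erase_ssubset hh))
    rw [linearIndepOn_finset_iff] at hi
    have := hi c (by rw [← hc, ← Finset.add_sum_erase _ _ hh, h0]; simp)
    have hgh : g ≠ h := by rintro rfl; exact hgne h0
    exact hgne (this g (by simp [hg, hgh]))
  have hsplit : ∑ g ∈ C ∩ A, c g • v g + ∑ g ∈ C ∩ B, c g • v g = 0 := by
    rw [← Finset.sum_union (Finset.disjoint_of_subset_left Finset.inter_subset_right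
      (Finset.disjoint_of_subset_right Finset.inter_subset_right hdis)),
      ← Finset.inter_union_distrib_left, hU, Finset.inter_univ, hc]
  have hne : ∑ g ∈ C ∩ A, c g • v g ≠ 0 := by
    intro h0
    have hss : C ∩ A ⊂ C := by
      refine Finset.ssubset_iff_subset_ne.mpr ⟨Finset.inter_subset_left, fun h => ?_⟩
      have : f ∈ C ∩ A := by rw [h]; exact hfC
      exact Finset.disjoint_left.mp hdis (Finset.mem_inter.mp this).2 hf
    have hi := (hindep _).mp (hmin _ hss)
    rw [linearIndepOn_finset_iff] at hi
    exact hall e heC (hi c h0 e (by simp [heC, he]))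
  have hmem : ∀ T : Finset E, ∑ g ∈ C ∩ T, c g • v g ∈ Submodule.span K (v '' T) := fun T =>
    sum_mem fun g hg => Submodule.smul_mem _ _
      (Submodule.subset_span ⟨g, (Finset.mem_inter.mp hg).2, rfl⟩)
  have hinf : 0 < Module.finrank K
      (Submodule.span K (v '' A) ⊓ Submodule.span K (v '' B) : Submodule K (Fin r → K)) := by
    rw [Nat.pos_iff_ne_zero]
    intro h0
    rw [Submodule.finrank_eq_zero] at h0
    apply hne
    have : ∑ g ∈ C ∩ A, c g • v g ∈ Submodule.span K (v '' A) ⊓ Submodule.span K (v '' B) :=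
      ⟨hmem A, by rw [eq_neg_of_add_eq_zero_left hsplit]; exact neg_mem (hmem B)⟩
    rw [h0] at this
    exact this
  have h2 := Submodule.finrank_sup_add_finrank_inf_eq (Submodule.span K (v '' A))
          (Submodule.span K (v '' B))
  rw [← Submodule.span_union, ← Set.image_union, ← Finset.coe_union, hU] at h2
  unfold rk
  omega

end Config

open scoped BigOperators
set_option linter.unusedSectionVars false
namespace Config
section ht
open Polynomial

lemma ht_comap_le {A : Type*} [CommRing A] [IsNoetherianRing A] (P : Ideal A[X]) [P.IsPrime] :
    (P.comap (C : A →+* A[X])).height ≤ P.height := by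
  have : P.LiesOver (P.comap (C : A →+* A[X])) := ⟨rfl⟩
  rw [Ideal.height_eq_height_add_of_liesOver_of_hasGoingDown (P.comap (C : A →+* A[X])) P]
  exact le_self_add

lemma ht_comap_add_one_le {A : Type*} [CommRing A] [IsNoetherianRing A] (P : Ideal A[X]) [P.IsPrime]
    (h : ¬ P ≤ (P.comap (C : A →+* A[X])).map (C : A →+* A[X])) :
    (P.comap (C : A →+* A[X])).height + 1 ≤ P.height := by
  set q := P.comap (C : A →+* A[X]) with hq
  have hqp : q.IsPrime := by rw [hq]; infer_instance
  have hp : (q.map (C : A →+* A[X])).IsPrime := Ideal.isPrime_map_C_of_isPrime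
  have hle : q.map (C : A →+* A[X]) ≤ P := Ideal.map_comap_le
  have hlt : q.map (C : A →+* A[X]) < P := lt_of_le_not_ge hle h
  refine le_trans ?_ (Ideal.height_add_one_le_of_lt_of_isPrime hlt)
  gcongr
  have := ht_comap_le (q.map (C : A →+* A[X]))
  refine le_trans (Ideal.height_mono Ideal.le_comap_map) this

variable {K : Type*} [Field K] {L : Type*} [Field L] [Algebra K L]

theorem card_le_height (σ : Type*) [Finite σ] : ∀ (x : σ → L),
    (Nat.card σ : ℕ∞) ≤ (RingHom.ker (MvPolynomial.aeval x : MvPolynomial σ K →ₐ[K] L)).height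
      + td K (Set.range x) := by
  induction σ using Finite.induction_empty_option with
  | @of_equiv α β e H =>
    intro x
    have h := H (x ∘ e)
    rw [← Nat.card_congr e]
    refine h.trans ?_
    rw [Set.range_comp, e.range_eq_univ, Set.image_univ]
    gcongr
    have : (RingHom.ker (MvPolynomial.aeval (x ∘ e) : MvPolynomial α K →ₐ[K] L))
      = (RingHom.ker (MvPolynomial.aeval x : MvPolynomial β K →ₐ[K] L)).comap
        (MvPolynomial.renameEquiv K e).toRingEquiv := by
      ext p
      simp [RingHom.mem_ker, MvPolynomial.aeval_rename]
    rw [this, RingEquiv.height_comap]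
  | h_empty => intro x; simp
  | @h_option α _ IH =>
    intro x
    have h := IH (fun a => x (some a))
    set y : α → L := fun a => x (some a) with hy
    set t := x none with ht
    let φ : (MvPolynomial α K)[X] →+* L :=
      Polynomial.eval₂RingHom (MvPolynomial.aeval y : MvPolynomial α K →ₐ[K] L).toRingHom t
    have e1 : (RingHom.ker (MvPolynomial.aeval x : MvPolynomial (Option α) K →ₐ[K] L)) =
        (RingHom.ker φ).comap (MvPolynomial.optionEquivLeft K α).toRingEquiv := by
      have : (MvPolynomial.aeval x : MvPolynomial (Option α) K →ₐ[K] L).toRingHom =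
          φ.comp (MvPolynomial.optionEquivLeft K α).toRingEquiv.toRingHom := by
        apply MvPolynomial.ringHom_ext
        · intro r
          simp [φ]
        · intro i
          cases i <;> simp [φ, hy, ht]
      ext p
      have := congrArg (fun f => f p = 0) this
      simpa [RingHom.mem_ker] using this
    rw [e1, RingEquiv.height_comap]
    set P := RingHom.ker φ with hP
    have hPp : P.IsPrime := RingHom.ker_isPrime φ
    have e2 : P.comap (C : _ →+* (MvPolynomial α K)[X]) =
        RingHom.ker (MvPolynomial.aeval y : MvPolynomial α K →ₐ[K] L) := by
      ext p; simp [hP, RingHom.mem_ker, φ]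
    have e3 : Set.range x = insert t (Set.range y) := by
      ext z; constructor
      · rintro ⟨_ | a, rfl⟩
        · exact Or.inl rfl
        · exact Or.inr ⟨a, rfl⟩
      · rintro (rfl | ⟨a, rfl⟩)
        · exact ⟨none, rfl⟩
        · exact ⟨some a, rfl⟩
    rw [e3, Finite.card_option]
    push_cast
    by_cases hc : t ∈ (AlgebraicIndependent.matroid K L).closure (Set.range y)
    · have hk : ¬ P ≤ (P.comap (C : _ →+* (MvPolynomial α K)[X])).map C := by
        rw [AlgebraicIndependent.matroid_closure_eq] at hc
        simp only [SetLike.mem_coe, Subalgebra.mem_algebraicClosure] at hc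
        obtain ⟨g, hg0, hg⟩ := hc
        -- lift g
        let f0 : MvPolynomial α K →ₐ[K] L := MvPolynomial.aeval y
        have hr : f0.range = Algebra.adjoin K (Set.range y) := by
          rw [Algebra.adjoin_range_eq_range_aeval]
        have hsurj : ∀ a : Algebra.adjoin K (Set.range y), ∃ p, f0 p = a := by
          intro a
          have : (a : L) ∈ f0.range := by rw [hr]; exact a.2
          exact this
        choose s hs using hsurj
        let G : (MvPolynomial α K)[X] := ∑ i ∈ g.support, Polynomial.monomial i (s (g.coeff i))
        have hcoef : ∀ i, f0 (G.coeff i) = g.coeff i := by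
          intro i
          simp only [G, Polynomial.finsetSum_coeff, Polynomial.coeff_monomial]
          rw [Finset.sum_ite_eq']
          split_ifs with hi
          · exact hs _
          · rw [Polynomial.notMem_support_iff.mp hi]; simp
        intro hle
        have hGP : G ∈ P := by
          rw [hP, RingHom.mem_ker]
          have : Polynomial.aeval t g = φ G := by
            simp only [φ, Polynomial.coe_eval₂RingHom, G, Polynomial.eval₂_finsetSum,
              Polynomial.eval₂_monomial]
            rw [Polynomial.aeval_eq_sum_range' (n := g.natDegree + 1) (by omega)]
            symm
            refine (Finset.sum_subset (s₂ := Finset.range (g.natDegree+1)) ?_ ?_).trans ?_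
            · intro i hi
              simp only [Finset.mem_range]
              exact Nat.lt_succ_of_le (Polynomial.le_natDegree_of_mem_supp i hi)
            · intro i _ hi
              have : f0 (s (g.coeff i)) = 0 := by
                rw [hs, Polynomial.notMem_support_iff.mp hi]; simp
              change f0 (s (g.coeff i)) * _ = 0
              rw [this, zero_mul]
            · refine Finset.sum_congr rfl fun i _ => ?_
              change f0 (s (g.coeff i)) * _ = _
              rw [hs, Algebra.smul_def]; rfl
          rw [← this, hg]
        have := Ideal.mem_map_C_iff.mp (hle hGP)
        apply hg0
        ext i
        have h1 := this i
        rw [e2, RingHom.mem_ker] at h1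
        have h2 := hcoef i
        change f0 _ = 0 at h1
        rw [← h2, h1]; simp
      have := ht_comap_add_one_le P hk
      rw [e2] at this
      calc (Nat.card α : ℕ∞) + 1 ≤ _ + _ + 1 := by gcongr
        _ = (RingHom.ker (MvPolynomial.aeval y : MvPolynomial α K →ₐ[K] L)).height + 1
            + td K (Set.range y) := by ring
        _ ≤ _ := add_le_add this (td_mono (Set.subset_insert _ _))
    · have h5 : td K (insert t (Set.range y)) = td K (Set.range y) + 1 :=
        Matroid.eRk_insert_eq_add_one ⟨Set.mem_univ _, hc⟩
      have := ht_comap_le P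
      rw [e2] at this
      rw [h5, ← add_assoc]
      gcongr
      exact h.trans (by gcongr)
end ht
end Config

open scoped BigOperators
set_option linter.unusedSectionVars false
namespace Config
section ev
open CategoryTheory Abelian Limits RingTheory.Sequence
variable {R : Type} [CommRing R]

/-- vanishing of `Ext^i(N, M)` for `i < n` -/
def EV (R : Type) [CommRing R] (N M : Type) [AddCommGroup N] [Module R N] [AddCommGroup M] [Module R M]
    (n : ℕ) : Prop :=
  ∀ i < n, Subsingleton (Ext (ModuleCat.of R N) (ModuleCat.of R M) i)

variable {N M M1 M2 M3 : Type} [AddCommGroup N] [Module R N] [AddCommGroup M] [Module R M]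
  [AddCommGroup M1] [Module R M1] [AddCommGroup M2] [Module R M2] [AddCommGroup M3] [Module R M3]

lemma ses_of (f : M1 →ₗ[R] M2) (g : M2 →ₗ[R] M3) (hf : Function.Injective f)
    (hg : Function.Surjective g) (hfg : Function.Exact f g) :
    (ShortComplex.mk (ModuleCat.ofHom f) (ModuleCat.ofHom g)
      (by ext x; exact hfg.apply_apply_eq_zero x)).ShortExact :=
  ShortComplex.ShortExact.mk' ((ShortComplex.ShortExact.moduleCat_exact_iff_function_exact _).mpr hfg)
    ((ModuleCat.mono_iff_injective _).mpr hf) ((ModuleCat.epi_iff_surjective _).mpr hg)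

lemma EV.ses3 (f : M1 →ₗ[R] M2) (g : M2 →ₗ[R] M3) (hf : Function.Injective f)
    (hg : Function.Surjective g) (hfg : Function.Exact f g) (n : ℕ)
    (h1 : EV R N M1 (n + 1)) (h2 : EV R N M2 n) : EV R N M3 n := by
  intro i hi
  have zero1 := AddCommGrpCat.isZero_of_iff_subsingleton.mpr (h2 i hi)
  have zero2 := AddCommGrpCat.isZero_of_iff_subsingleton.mpr (h1 (i + 1) (by omega))
  exact AddCommGrpCat.subsingleton_of_isZero <| ShortComplex.Exact.isZero_of_both_zeros
    ((Ext.covariant_sequence_exact₃' (ModuleCat.of R N) (ses_of f g hf hg hfg)) i (i + 1) rfl)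
    (zero1.eq_zero_of_src _) (zero2.eq_zero_of_tgt _)

lemma EV.ses2 (f : M1 →ₗ[R] M2) (g : M2 →ₗ[R] M3) (hf : Function.Injective f)
    (hg : Function.Surjective g) (hfg : Function.Exact f g) (n : ℕ)
    (h1 : EV R N M1 n) (h3 : EV R N M3 n) : EV R N M2 n := by
  intro i hi
  have zero1 := AddCommGrpCat.isZero_of_iff_subsingleton.mpr (h1 i hi)
  have zero2 := AddCommGrpCat.isZero_of_iff_subsingleton.mpr (h3 i hi)
  exact AddCommGrpCat.subsingleton_of_isZero <| ShortComplex.Exact.isZero_of_both_zeros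
    ((Ext.covariant_sequence_exact₂' (ModuleCat.of R N) (ses_of f g hf hg hfg)) i)
    (zero1.eq_zero_of_src _) (zero2.eq_zero_of_tgt _)

lemma EV.mono {m n : ℕ} (hmn : m ≤ n) (h : EV R N M n) : EV R N M m :=
  fun i hi => h i (hi.trans_le hmn)

lemma EV.retract (s : M1 →ₗ[R] M2) (t : M2 →ₗ[R] M1) (hst : ∀ x, t (s x) = x) (n : ℕ)
    (h : EV R N M2 n) : EV R N M1 n := by
  intro i hi
  have hs := h i hi
  refine ⟨fun a b => ?_⟩
  have key : ∀ x : Ext (ModuleCat.of R N) (ModuleCat.of R M1) i,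
      x = (x.comp (Ext.mk₀ (ModuleCat.ofHom s)) (add_zero i)).comp (Ext.mk₀ (ModuleCat.ofHom t))
        (add_zero i) := by
    intro x
    rw [Ext.comp_assoc_of_second_deg_zero, Ext.mk₀_comp_mk₀]
    have : ModuleCat.ofHom s ≫ ModuleCat.ofHom t = 𝟙 _ := by
      ext x; exact hst x
    rw [this, Ext.comp_mk₀_id]
  rw [key a, key b, Subsingleton.elim (a.comp (Ext.mk₀ (ModuleCat.ofHom s)) (add_zero i))
    (b.comp (Ext.mk₀ (ModuleCat.ofHom s)) (add_zero i))]

lemma EV.fin (n k : ℕ) (h : EV R N R n) : EV R N (Fin k → R) n := by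
  induction k with
  | zero =>
    refine EV.retract (M2 := R) (0 : (Fin 0 → R) →ₗ[R] R) 0 (fun x => Subsingleton.elim _ _) n h
  | succ k ih =>
    refine EV.ses2 (M1 := R) (M3 := Fin k → R) (LinearMap.single R (fun _ : Fin (k+1) => R) 0)
      (LinearMap.funLeft R R Fin.succ) (fun a b h => by simpa using congrFun h 0) ?_ ?_ n h ih
    · exact LinearMap.funLeft_surjective_of_injective _ _ _ (Fin.succ_injective _)
    · intro x
      constructor
      · intro hx
        refine ⟨x 0, ?_⟩
        funext i
        refine Fin.cases ?_ (fun j => ?_) i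
        · simp
        · have := congrFun hx j
          simpa using this.symm
      · rintro ⟨y, rfl⟩
        funext j
        simp [LinearMap.funLeft_apply]

lemma EV.fintype {ι : Type} [Finite ι] (n : ℕ) (h : EV R N R n) : EV R N (ι → R) n := by
  obtain ⟨k, ⟨e⟩⟩ := Finite.exists_equiv_fin ι
  exact EV.retract (LinearEquiv.funCongrLeft R R e.symm).toLinearMap
    (LinearEquiv.funCongrLeft R R e).toLinearMap (fun x => by ext; simp [LinearMap.funLeft_apply]) n (EV.fin n k h)

/-- vanishing of Hom -/
lemma EV.hom_zero (h : EV R N M 1) (f : N →ₗ[R] M) : f = 0 := by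
  have : Subsingleton (ModuleCat.of R N ⟶ ModuleCat.of R M) :=
    Ext.addEquiv₀.subsingleton_congr.mp (h 0 (by omega))
  have : Subsingleton (N →ₗ[R] M) := (ModuleCat.homAddEquiv (M := ModuleCat.of R N) (N := ModuleCat.of R M)).symm.subsingleton
  exact Subsingleton.elim _ _

lemma EV.no_ass [IsNoetherianRing R] (P : Ideal R) (hP : P ≠ ⊤) (h : EV R (R ⧸ P) M 1) : P ∉ associatedPrimes R M := by
  intro hass
  obtain ⟨f, hf⟩ := (isAssociatedPrime_iff_exists_injective_linearMap P M).mp hass |>.2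
  have := h.hom_zero f
  subst this
  apply hP
  rw [← Ideal.Quotient.subsingleton_iff]
  exact ⟨fun a b => hf rfl⟩

/-- sequences kill degrees one by one -/
lemma EV.quot (rs : List R) : ∀ (M : Type) [AddCommGroup M] [Module R M] (n : ℕ),
    IsWeaklyRegular M rs → EV R N M (n + rs.length) →
    EV R N (M ⧸ (Ideal.ofList rs • (⊤ : Submodule R M))) n := by
  induction rs with
  | nil =>
    intro M _ _ n _ h
    let e : M ≃ₗ[R] (M ⧸ (Ideal.ofList ([] : List R) • (⊤ : Submodule R M))) :=
      (Submodule.quotEquivOfEqBot _ (by simp)).symm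
    exact EV.retract e.symm.toLinearMap e.toLinearMap (fun x => by simp) n (by simpa using h)
  | cons r rs ih =>
    intro M _ _ n hreg h
    rw [isWeaklyRegular_cons_iff] at hreg
    have h2 : EV R N (QuotSMulTop r M) (n + rs.length) := by
      refine EV.ses3 (LinearMap.lsmul R M r) (Submodule.mkQ _) hreg.1
        (Submodule.mkQ_surjective _) (LinearMap.exact_lsmul_mkQ_smul_top M r) _ h ?_
      exact h.mono (by simp)
    have h3 := ih (QuotSMulTop r M) n hreg.2 h2
    let e := Submodule.quotOfListConsSMulTopEquivQuotSMulTopInner M r rs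
    exact EV.retract e.toLinearMap e.symm.toLinearMap (fun x => by simp) n h3

/-- from sequences to Ext -/
lemma EV.of_seq [IsNoetherianRing R] [Module.Finite R M] (P : Ideal R) (rs : List R) (hm : ∀ r ∈ rs, r ∈ P)
    (hM : P • (⊤ : Submodule R M) ≠ ⊤)
    (hreg : IsWeaklyRegular M rs) : EV R (R ⧸ P) M rs.length := by
  refine ModuleCat.subsingleton_ext_of_exists_isRegular P (ModuleCat.of R (R ⧸ P)) ?_
    (ModuleCat.of R M) hM.lt_top rs hm ⟨hreg, ?_⟩
  · show Module.support R (R ⧸ P) ⊆ _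
    rw [Module.support_eq_zeroLocus, Ideal.annihilator_quotient]
  · intro h
    apply hM
    rw [eq_top_iff]
    refine le_trans h.le (Submodule.smul_mono_left ?_)
    rw [Ideal.ofList, Ideal.span_le]
    exact hm

/-- from Ext to sequences -/
lemma EV.exists_seq [IsNoetherianRing R] [Module.Finite R M] (P : Ideal R) (n : ℕ)
    (hM : P • (⊤ : Submodule R M) ≠ ⊤)
    (h : EV R (R ⧸ P) M n) : ∃ rs : List R, rs.length = n ∧ (∀ r ∈ rs, r ∈ P) ∧ IsRegular M rs := by
  refine ModuleCat.exists_isRegular_of_exists_subsingleton_ext P n (ModuleCat.of R M) hM.lt_top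
    (ModuleCat.of R (R ⧸ P)) ?_ h
  show Module.support R (R ⧸ P) = _
  rw [Module.support_eq_zeroLocus, Ideal.annihilator_quotient]

end ev
end Config

open scoped BigOperators
set_option linter.unusedSectionVars false
namespace Config
section gr
open Polynomial RingTheory.Sequence

lemma no_chain {A : Type*} [CommRing A] (q : Ideal A) (Q1 Q2 Q3 : Ideal A[X]) [h1 : Q1.IsPrime]
    [h2 : Q2.IsPrime] [h3 : Q3.IsPrime] (h12 : Q1 < Q2) (h23 : Q2 < Q3)
    (e1 : Q1.comap (C : A →+* A[X]) = q) (e2 : Q2.comap (C : A →+* A[X]) = q)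
    (e3 : Q3.comap (C : A →+* A[X]) = q) : False := by
  have hq : q.IsPrime := by rw [← e1]; infer_instance
  let p : PrimeSpectrum A := ⟨q, hq⟩
  have hd : Order.krullDim (PrimeSpectrum.comap (algebraMap A A[X]) ⁻¹' {p}) ≤ 1 := by
    rw [Order.krullDim_eq_of_orderIso
      (PrimeSpectrum.preimageOrderIsoFiber A (Polynomial A) p), ← ringKrullDim,
      ← ringKrullDim_eq_of_ringEquiv (polyEquivTensor A (p.asIdeal.ResidueField)).toRingEquiv]
    have : Ring.KrullDimLE 1 (p.asIdeal.ResidueField)[X] := inferInstance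
    exact_mod_cast (Ring.krullDimLE_iff).mp this
  let P1 : (PrimeSpectrum.comap (algebraMap A A[X]) ⁻¹' {p}) := ⟨⟨Q1, h1⟩, by
    rw [Set.mem_preimage, Set.mem_singleton_iff]; ext1; exact e1⟩
  let P2 : (PrimeSpectrum.comap (algebraMap A A[X]) ⁻¹' {p}) := ⟨⟨Q2, h2⟩, by
    rw [Set.mem_preimage, Set.mem_singleton_iff]; ext1; exact e2⟩
  let P3 : (PrimeSpectrum.comap (algebraMap A A[X]) ⁻¹' {p}) := ⟨⟨Q3, h3⟩, by
    rw [Set.mem_preimage, Set.mem_singleton_iff]; ext1; exact e3⟩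
  have a12 : P1 < P2 := h12
  have a23 : P2 < P3 := h23
  have b12 := Order.height_add_one_le a12
  have b23 := Order.height_add_one_le a23
  have b3 : ((Order.height P3 : ℕ∞) : WithBot ℕ∞) ≤ 1 := (Order.height_le_krullDim P3).trans hd
  have b4 : Order.height P3 ≤ 1 := by exact_mod_cast b3
  have : (2 : ℕ∞) ≤ 1 := by
    calc (2 : ℕ∞) = 0 + 1 + 1 := by norm_num
      _ ≤ Order.height P1 + 1 + 1 := by gcongr; exact zero_le
      _ ≤ Order.height P2 + 1 := by gcongr
      _ ≤ _ := b23
      _ ≤ 1 := b4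
  exact absurd this (by decide)

lemma ht_le_comap_add_one {A : Type*} [CommRing A] [IsNoetherianRing A] (P : Ideal A[X]) [P.IsPrime] :
    P.height ≤ (P.comap (C : A →+* A[X])).height + 1 := by
  set q := P.comap (C : A →+* A[X]) with hq
  have hl : P.LiesOver q := ⟨rfl⟩
  have hqp : q.IsPrime := by rw [hq]; infer_instance
  refine (Ideal.height_le_height_add_of_liesOver q P).trans ?_
  gcongr
  have hker : RingHom.ker (Ideal.Quotient.mk (q.map (algebraMap A A[X]))) ≤ P := by
    rw [Ideal.mk_ker]; exact Ideal.map_comap_le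
  have hpr : (P.map (Ideal.Quotient.mk (q.map (algebraMap A A[X])))).IsPrime :=
    Ideal.map_isPrime_of_surjective Ideal.Quotient.mk_surjective hker
  have hcm : (P.map (Ideal.Quotient.mk (q.map (algebraMap A A[X])))).comap
      (Ideal.Quotient.mk (q.map (algebraMap A A[X]))) = P := by
    rw [Ideal.comap_map_of_surjective' _ Ideal.Quotient.mk_surjective]
    exact sup_eq_left.mpr hker
  have hfib : ∀ Q : Ideal (A[X] ⧸ q.map (algebraMap A A[X])), Q ≤ P.map (Ideal.Quotient.mk _) →
      (Q.comap (Ideal.Quotient.mk (q.map (algebraMap A A[X])))).comap (C : A →+* A[X]) = q := by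
    intro Q hQ
    apply le_antisymm
    · refine le_trans (Ideal.comap_mono (Ideal.comap_mono hQ)) ?_
      rw [hcm]
    · intro a ha
      simp only [Ideal.mem_comap]
      have : (Ideal.Quotient.mk (q.map (algebraMap A A[X]))) (C a) = 0 :=
        Ideal.Quotient.eq_zero_iff_mem.mpr (Ideal.mem_map_of_mem _ ha)
      rw [this]; exact Q.zero_mem
  have key : (P.map (Ideal.Quotient.mk (q.map (algebraMap A A[X])))).height ≤ (1 : ℕ) := by
    rw [Ideal.height_le_iff]
    intro Q hQ hQP
    by_contra hcon
    have h0 : ¬ Q.height ≤ (0 : ℕ) := by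
      intro h
      exact hcon (lt_of_le_of_lt h (by norm_num))
    rw [Ideal.height_le_iff] at h0
    push Not at h0
    obtain ⟨Q0, hQ0, hlt, -⟩ := h0
    have hs : ∀ {a b : Ideal (A[X] ⧸ q.map (algebraMap A A[X]))}, a < b →
      a.comap (Ideal.Quotient.mk (q.map (algebraMap A A[X]))) < b.comap (Ideal.Quotient.mk _) := by
      intro a b hab
      refine lt_of_le_not_ge (Ideal.comap_mono hab.le) fun h => hab.not_ge ?_
      exact (Ideal.comap_le_comap_iff_of_surjective _ Ideal.Quotient.mk_surjective _ _).mp h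
    exact no_chain q _ _ _ (hs hlt) (hs hQP) (hfib _ (hlt.le.trans hQP.le)) (hfib _ hQP.le)
      (hfib _ le_rfl)
  exact_mod_cast key

section avoid
variable {R : Type} [CommRing R] [IsNoetherianRing R]

lemma ass_iff (J Q : Ideal R) : Q ∈ associatedPrimes R (R ⧸ J) ↔
    Q.IsPrime ∧ ∃ g, ∀ h, h ∈ Q ↔ h * g ∈ J := by
  change (⊥ : Submodule R (R ⧸ J)).IsAssociatedPrime Q ↔ _
  rw [Submodule.isAssociatedPrime_iff]
  refine and_congr_right fun _ => ?_
  have key : ∀ g h : R, h ∈ Submodule.colon (⊥ : Submodule R (R ⧸ J)) {Ideal.Quotient.mk J g} ↔ h * g ∈ J := by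
    intro g h
    rw [Submodule.mem_colon_singleton, Submodule.mem_bot, ← Ideal.Quotient.eq_zero_iff_mem, map_mul]
    rfl
  constructor
  · rintro ⟨x, rfl⟩
    obtain ⟨g, rfl⟩ := Ideal.Quotient.mk_surjective x
    exact ⟨g, key g⟩
  · rintro ⟨g, hg⟩
    exact ⟨Ideal.Quotient.mk J g, by ext h; rw [hg, key]⟩

lemma avoid (J P : Ideal R) : (∃ y ∈ P, ∀ h, y * h ∈ J → h ∈ J) ∨
    ∃ Q ∈ associatedPrimes R (R ⧸ J), P ≤ Q := by
  by_cases hc : (P : Set R) ⊆ ⋃ p ∈ associatedPrimes R (R ⧸ J), (p : Set R)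
  · right
    have hfin := associatedPrimes.finite R (R ⧸ J)
    have hc' : (P : Set R) ⊆ ⋃ p ∈ (hfin.toFinset : Set (Ideal R)), ((id p : Ideal R) : Set R) := by
      simpa using hc
    rw [Ideal.subset_union_prime (f := id) ⊥ ⊥ (by
      intro i hi _ _
      exact ((ass_iff J i).mp (hfin.mem_toFinset.mp hi)).1)] at hc'
    obtain ⟨Q, hQ, hPQ⟩ := hc'
    exact ⟨Q, hfin.mem_toFinset.mp hQ, hPQ⟩
  · left
    rw [Set.not_subset] at hc
    obtain ⟨y, hyP, hy⟩ := hc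
    rw [biUnion_associatedPrimes_eq_compl_regular, Set.notMem_compl_iff, Set.mem_ofPred_eq] at hy
    refine ⟨y, hyP, fun h hh => ?_⟩
    have : y • (Ideal.Quotient.mk J h) = y • (0 : R ⧸ J) := by
      rw [smul_zero]
      exact Ideal.Quotient.eq_zero_iff_mem.mpr hh
    exact Ideal.Quotient.eq_zero_iff_mem.mp (hy this)

lemma wr_append {R : Type} [CommRing R] (rs : List R) (y : R) (h : IsWeaklyRegular R rs)
    (hy : ∀ h, y * h ∈ Ideal.ofList rs → h ∈ Ideal.ofList rs) : IsWeaklyRegular R (rs ++ [y]) := by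
  rw [isWeaklyRegular_append_iff, isWeaklyRegular_singleton_iff]
  refine ⟨h, ?_⟩
  rw [isSMulRegular_iff_right_eq_zero_of_smul]
  intro x hx
  obtain ⟨x, rfl⟩ := Submodule.mkQ_surjective _ x
  rw [← map_smul, Submodule.mkQ_apply, Submodule.Quotient.mk_eq_zero] at hx
  rw [Submodule.mkQ_apply, Submodule.Quotient.mk_eq_zero]
  simp only [smul_eq_mul, Ideal.mul_top] at hx ⊢
  exact hy x hx

/-- every prime contains a weakly regular sequence of length its height -/
def GG (A : Type) [CommRing A] : Prop :=
  ∀ q : Ideal A, q.IsPrime → ∃ rs : List A, (∀ r ∈ rs, r ∈ q) ∧ IsWeaklyRegular A rs ∧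
    q.height = rs.length

lemma EV.quotR {R N : Type} [CommRing R] [AddCommGroup N] [Module R N] (rs : List R) (n : ℕ) (h : IsWeaklyRegular R rs)
    (hE : EV R N R (n + rs.length)) : EV R N (R ⧸ Ideal.ofList rs) n := by
  have h3 := EV.quot rs R n h hE
  let e : (R ⧸ Ideal.ofList rs) ≃ₗ[R] (R ⧸ (Ideal.ofList rs • (⊤ : Submodule R R))) :=
    Submodule.quotEquivOfEq _ _ (by simp)
  exact EV.retract e.toLinearMap e.symm.toLinearMap (fun x => by simp) n h3

lemma GG.EV (hG : GG R) (P : Ideal R) (hP : P.IsPrime) (n : ℕ) (hn : P.height = n) :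
    EV R (R ⧸ P) R n := by
  obtain ⟨rs, h1, h2, h3⟩ := hG P hP
  have : n = rs.length := by rw [hn] at h3; exact_mod_cast h3
  rw [this]
  refine EV.of_seq P rs h1 ?_ h2
  simpa using hP.ne_top

lemma GG.unmixed (hG : GG R) (rs : List R) (h : IsWeaklyRegular R rs) (Q : Ideal R)
    (hQ : Q ∈ associatedPrimes R (R ⧸ Ideal.ofList rs)) : Q.height ≤ rs.length := by
  have hQp := ((ass_iff _ Q).mp hQ).1
  obtain ⟨n, hn⟩ : ∃ n : ℕ, Q.height = n :=
    ⟨_, (ENat.natCast_toNat (Ideal.height_ne_top_of_isPrime)).symm⟩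
  rw [hn]
  by_contra hcon
  have hcon : rs.length < n := by exact_mod_cast not_le.mp hcon
  have hE := (hG.EV Q hQp n hn).mono (show 1 + rs.length ≤ n by omega)
  exact EV.no_ass Q hQp.ne_top (EV.quotR rs 1 h hE) hQ

end avoid

lemma GG.equiv {A B : Type} [CommRing A] [CommRing B] (e : A ≃+* B) (h : GG A) : GG B := by
  intro q hq
  obtain ⟨rs, h1, h2, h3⟩ := h (q.comap e) inferInstance
  refine ⟨rs.map e, ?_, ?_, ?_⟩
  · intro r hr
    obtain ⟨a, ha, rfl⟩ := List.mem_map.mp hr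
    exact h1 a ha
  · refine (AddEquiv.isWeaklyRegular_congr (e := e.toAddEquiv) ?_).mp h2
    refine List.forall₂_map_right_iff.mpr <| List.forall₂_same.mpr fun r _ x => ?_
    simp
  · rw [List.length_map, ← h3, RingEquiv.height_comap]

lemma GG.field {K : Type} [Field K] : GG K := by
  intro q hq
  have : q = ⊥ := (Ideal.eq_bot_or_top q).resolve_right hq.ne_top
  subst this
  exact ⟨[], by simp, by simp, by simp⟩

lemma GG.poly {A : Type} [CommRing A] [IsNoetherianRing A] (hG : GG A) : GG A[X] := by
  intro P hP
  set q := P.comap (C : A →+* A[X]) with hq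
  have hqp : q.IsPrime := by rw [hq]; infer_instance
  obtain ⟨f, hfq, hfr, hfl⟩ := hG q hqp
  have hfr' : IsWeaklyRegular A[X] (f.map (C : A →+* A[X])) := IsWeaklyRegular.of_flat hfr
  have hfP : ∀ r ∈ f.map (C : A →+* A[X]), r ∈ P := by
    intro r hr
    obtain ⟨a, ha, rfl⟩ := List.mem_map.mp hr
    exact hfq a ha
  by_cases hPq : P ≤ q.map C
  · refine ⟨f.map C, hfP, hfr', ?_⟩
    rw [List.length_map, ← hfl]
    have hPe : P = q.map C := le_antisymm hPq Ideal.map_comap_le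
    refine le_antisymm ?_ (ht_comap_le P)
    have hl : P.LiesOver q := ⟨rfl⟩
    refine (Ideal.height_le_height_add_of_liesOver q P).trans ?_
    have : P.map (Ideal.Quotient.mk (q.map (algebraMap A A[X]))) = ⊥ := by
      rw [Ideal.map_eq_bot_iff_le_ker, Ideal.mk_ker]; exact hPq
    rw [this]
    have : Nontrivial (A[X] ⧸ q.map (algebraMap A A[X])) :=
      Ideal.Quotient.nontrivial_iff.mpr (by
        change q.map C ≠ ⊤
        rw [← hPe]; exact hP.ne_top)
    rw [Ideal.height_bot, add_zero]
  · set J := Ideal.ofList f with hJ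
    have hJX : Ideal.ofList (f.map (C : A →+* A[X])) = J.map C := (Ideal.map_ofList _ _).symm
    rcases avoid (J.map (C : A →+* A[X])) P with ⟨y, hyP, hy⟩ | ⟨Q, hQ, hPQ⟩
    · refine ⟨f.map C ++ [y], ?_, ?_, ?_⟩
      · intro r hr
        rcases List.mem_append.mp hr with h | h
        · exact hfP r h
        · rw [List.mem_singleton.mp h]; exact hyP
      · refine wr_append _ _ hfr' ?_
        rw [hJX]; exact hy
      · simp only [List.length_append, List.length_map, List.length_singleton]
        push_cast
        rw [← hfl]
        exact le_antisymm (ht_le_comap_add_one P) (ht_comap_add_one_le P hPq)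
    · exfalso
      obtain ⟨hQp, hQ⟩ := (ass_iff _ Q).mp hQ
      -- Q ∩ A = q
      have hQA : Q.comap (C : A →+* A[X]) = q := by
        have hle : q ≤ Q.comap (C : A →+* A[X]) := Ideal.comap_mono hPQ
        obtain ⟨g, hg⟩ := hQ
        rcases avoid J (Q.comap (C : A →+* A[X])) with ⟨y, hyQ, hy⟩ | ⟨q', hq', hQq'⟩
        · exfalso
          have h1 : C y * g ∈ J.map C := (hg _).mp hyQ
          apply hQp.ne_top
          rw [Ideal.eq_top_iff_one, hg, one_mul, Ideal.mem_map_C_iff]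
          intro n
          apply hy
          have := Ideal.mem_map_C_iff.mp h1 n
          rwa [Polynomial.coeff_C_mul] at this
        · have hh := hG.unmixed f hfr q' hq'
          rw [← hfl] at hh
          have := Ideal.eq_of_le_of_height_le q (hle.trans hQq') hh
          exact le_antisymm (this ▸ hQq') hle
      -- y
      have hy : ∃ y ∈ P, y.leadingCoeff ∉ q := by
        by_contra! hcon
        apply hPq
        have : ∀ n : ℕ, ∀ y ∈ P, y.support.card = n → y ∈ q.map C := by
          intro n
          induction n using Nat.strong_induction_on with
          | _ n ih =>
            intro y hy hn
            by_cases hy0 : y = 0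
            · rw [hy0]; exact Ideal.zero_mem _
            have h1 := hcon y hy
            have h2 : Polynomial.monomial y.natDegree y.leadingCoeff ∈ q.map C := by
              rw [← Polynomial.C_mul_X_pow_eq_monomial]
              exact Ideal.mul_mem_right _ _ (Ideal.mem_map_of_mem _ h1)
            have h3 : y.eraseLead ∈ P := by
              have := Polynomial.eraseLead_add_monomial_natDegree_leadingCoeff y
              have h4 : Polynomial.monomial y.natDegree y.leadingCoeff ∈ P :=
                Ideal.map_comap_le h2
              rw [← this] at hy
              exact (Ideal.add_mem_iff_left _ h4).mp hy
            have h5 := ih _ (by rw [← hn]; exact Polynomial.eraseLead_support_card_lt hy0) _ h3 rfl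
            rw [← Polynomial.eraseLead_add_monomial_natDegree_leadingCoeff y]
            exact Ideal.add_mem _ h5 h2
        exact fun y hy => this _ y hy rfl
      obtain ⟨y, hyP, hyl⟩ := hy
      have hdesc : ∀ n : ℕ, ∀ g : A[X], (∀ h, h ∈ Q ↔ h * g ∈ J.map C) → g.support.card = n → False := by
        intro n
        induction n using Nat.strong_induction_on with
        | _ n ih =>
          intro g hg hn
          have hg0 : g ≠ 0 := by
            rintro rfl
            apply hQp.ne_top
            rw [Ideal.eq_top_iff_one, hg]; simp
          have h1 : y * g ∈ J.map C := (hg y).mp (hPQ hyP)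
          have h2 : y.leadingCoeff * g.leadingCoeff ∈ J := by
            have := Ideal.mem_map_C_iff.mp h1 (y.natDegree + g.natDegree)
            rwa [Polynomial.coeff_mul_degree_add_degree] at this
          have h3 : C y.leadingCoeff * Polynomial.monomial g.natDegree g.leadingCoeff ∈ J.map C := by
            rw [Polynomial.C_mul_monomial, ← Polynomial.C_mul_X_pow_eq_monomial]
            exact Ideal.mul_mem_right _ _ (Ideal.mem_map_of_mem _ h2)
          refine ih _ ?_ (C y.leadingCoeff * g.eraseLead) ?_ rfl
          · rw [← hn]
            refine lt_of_le_of_lt (Finset.card_le_card ?_) (Polynomial.eraseLead_support_card_lt hg0)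
            intro i hi
            rw [Polynomial.mem_support_iff] at hi ⊢
            intro h
            apply hi
            rw [Polynomial.coeff_C_mul, h, mul_zero]
          · intro h
            have h4 : h * (C y.leadingCoeff * g.eraseLead) =
                h * C y.leadingCoeff * g - h * (C y.leadingCoeff * Polynomial.monomial g.natDegree g.leadingCoeff) := by
              conv_rhs => rw [← Polynomial.eraseLead_add_monomial_natDegree_leadingCoeff g]
              simp only [Polynomial.eraseLead_add_monomial_natDegree_leadingCoeff]
              have := Polynomial.eraseLead_add_monomial_natDegree_leadingCoeff g
              linear_combination h * C y.leadingCoeff * this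
            rw [h4, sub_eq_add_neg, Ideal.add_mem_iff_left _ (Ideal.neg_mem_iff _ |>.mpr (Ideal.mul_mem_left _ _ h3)), ← hg]
            constructor
            · intro hh; exact Ideal.mul_mem_right _ _ hh
            · intro hh
              refine (hQp.mem_or_mem hh).resolve_right fun hc => hyl ?_
              rw [← hQA]; exact hc
      obtain ⟨g, hg⟩ := hQ
      exact hdesc _ g hg rfl

lemma GG.mv {K : Type} [Field K] (σ : Type) [Finite σ] : GG (MvPolynomial σ K) := by
  induction σ using Finite.induction_empty_option with
  | of_equiv e H => exact H.equiv (MvPolynomial.renameEquiv K e).toRingEquiv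
  | h_empty => exact GG.field.equiv (MvPolynomial.isEmptyAlgEquiv K PEmpty).symm.toRingEquiv
  | h_option IH => exact IH.poly.equiv (MvPolynomial.optionEquivLeft K _).symm.toRingEquiv

/-- an ideal all of whose primes have height at least `k` contains a regular sequence of length `k` -/
lemma GG.exists_seq {R : Type} [CommRing R] [IsNoetherianRing R] (hG : GG R) (J : Ideal R) (k : ℕ)
    (hJ : ∀ P : Ideal R, P.IsPrime → J ≤ P → (k : ℕ∞) ≤ P.height) :
    ∃ rs : List R, rs.length = k ∧ (∀ r ∈ rs, r ∈ J) ∧ IsWeaklyRegular R rs := by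
  suffices ∀ j ≤ k, ∃ rs : List R, rs.length = j ∧ (∀ r ∈ rs, r ∈ J) ∧ IsWeaklyRegular R rs from
    this k le_rfl
  intro j
  induction j with
  | zero => intro _; exact ⟨[], by simp⟩
  | succ j ih =>
    intro hj
    obtain ⟨rs, h1, h2, h3⟩ := ih (by omega)
    rcases avoid (Ideal.ofList rs) J with ⟨y, hyP, hy⟩ | ⟨Q, hQ, hPQ⟩
    · refine ⟨rs ++ [y], by simp [h1], ?_, wr_append rs y h3 hy⟩
      intro r hr
      rcases List.mem_append.mp hr with h | h
      · exact h2 r h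
      · rw [List.mem_singleton.mp h]; exact hyP
    · exfalso
      have h4 := hG.unmixed rs h3 Q hQ
      have h5 := hJ Q ((ass_iff _ Q).mp hQ).1 hPQ
      have : (k : ℕ∞) ≤ rs.length := h5.trans h4
      have : k ≤ rs.length := by exact_mod_cast this
      omega

/-- regular sequences are bounded by the height -/
lemma reg_le_height {R : Type} [CommRing R] [IsNoetherianRing R] (P : Ideal R) [P.IsPrime]
    (rs : List R) (h : IsWeaklyRegular R rs) (hm : ∀ r ∈ rs, r ∈ P) : (rs.length : ℕ∞) ≤ P.height := by
  have h1 := IsWeaklyRegular.isRegular_of_isLocalization_of_mem (Localization.AtPrime P) P h hm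
  have hN : IsNoetherianRing (Localization.AtPrime P) :=
    IsLocalization.isNoetherianRing P.primeCompl _ inferInstance
  have h2 := ringKrullDim_add_length_eq_ringKrullDim_of_isRegular _ h1
  rw [IsLocalization.AtPrime.ringKrullDim_eq_height P (Localization.AtPrime P), List.length_map] at h2
  have hnt : Nontrivial (Localization.AtPrime P ⧸
    Ideal.ofList (rs.map (algebraMap R (Localization.AtPrime P)))) := by
    rw [Ideal.Quotient.nontrivial_iff]
    intro hh
    apply h1.top_ne_smul
    rw [hh]; simp
  have h3 : (0 : WithBot ℕ∞) ≤ ringKrullDim (Localization.AtPrime P ⧸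
    Ideal.ofList (rs.map (algebraMap R (Localization.AtPrime P)))) := ringKrullDim_nonneg_of_nontrivial
  have h4 : ((rs.length : ℕ∞) : WithBot ℕ∞) ≤ (P.height : WithBot ℕ∞) := by
    rw [← h2]
    exact le_add_of_nonneg_left h3
  exact_mod_cast h4
end gr
end Config

open scoped BigOperators
set_option linter.unusedSectionVars false
namespace Config
section mat
open Matrix
variable {R : Type*} [CommRing R] {n : Type*} [Fintype n] [DecidableEq n] [LinearOrder n]

/-- alternating matrices -/
def Alt (R : Type*) [CommRing R] (n : Type*) : Submodule R (Matrix n n R) where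
  carrier := {N | Nᵀ = -N ∧ ∀ i, N i i = 0}
  add_mem' := by
    rintro a b ⟨ha, ha'⟩ ⟨hb, hb'⟩
    exact ⟨by rw [Matrix.transpose_add, ha, hb, neg_add], fun i => by simp [ha', hb']⟩
  zero_mem' := by simp
  smul_mem' := by
    rintro c a ⟨ha, ha'⟩
    exact ⟨by rw [Matrix.transpose_smul, ha, smul_neg], fun i => by simp [ha']⟩

lemma alt_sub (U : Matrix n n R) : U - Uᵀ ∈ Alt R n := by
  refine ⟨by simp, fun i => by simp⟩

/-- strictly upper triangular part -/
def upper : Matrix n n R →ₗ[R] Matrix n n R where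
  toFun Y := Matrix.of fun i j => if i < j then Y i j else 0
  map_add' a b := by ext i j; by_cases h : i < j <;> simp [h]
  map_smul' a b := by ext i j; by_cases h : i < j <;> simp [h]

/-- retraction to alternating matrices -/
def altRetr : Matrix n n R →ₗ[R] Alt R n :=
  LinearMap.codRestrict (Alt R n)
    (upper - (Matrix.transposeLinearEquiv n n R R).toLinearMap ∘ₗ upper)
    (fun Y => alt_sub (upper Y))

lemma alt_eq {N : Matrix n n R} (hN : N ∈ Alt R n) : N = upper N - (upper N)ᵀ := by
  obtain ⟨h1, h2⟩ := hN
  ext i j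
  have h3 : N j i = - N i j := congrFun (congrFun h1 i) j
  rcases lt_trichotomy i j with h | h | h
  · simp [upper, h, h.not_gt]
  · subst h; simp [upper, h2]
  · simp [upper, h, h.not_gt, h3]

lemma altRetr_apply (N : Alt R n) : altRetr (N : Matrix n n R) = N := by
  apply Subtype.ext
  exact (alt_eq N.2).symm

lemma alt_conj (X : Matrix n n R) {N : Matrix n n R} (hN : N ∈ Alt R n) : X * N * Xᵀ ∈ Alt R n := by
  rw [alt_eq hN]
  have : X * (upper N - (upper N)ᵀ) * Xᵀ = X * upper N * Xᵀ - (X * upper N * Xᵀ)ᵀ := by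
    simp only [Matrix.transpose_mul, Matrix.transpose_transpose, Matrix.mul_sub, Matrix.sub_mul,
      Matrix.mul_assoc]
  rw [this]
  exact alt_sub _

lemma trace_sym_alt {A N : Matrix n n R} (hA : Aᵀ = A) (hN : N ∈ Alt R n) : (A * N).trace = 0 := by
  rw [alt_eq hN, Matrix.mul_sub, Matrix.trace_sub, sub_eq_zero]
  rw [← Matrix.trace_transpose (A * (upper N)ᵀ), Matrix.transpose_mul, hA, Matrix.transpose_transpose,
    Matrix.trace_mul_comm]

variable [IsDomain R]

lemma alt_of_smul {c : R} (hc : c ≠ 0) {N : Matrix n n R} (h : c • N ∈ Alt R n) : N ∈ Alt R n := by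
  obtain ⟨h1, h2⟩ := h
  refine ⟨?_, fun i => ?_⟩
  · ext i j
    have := congrFun (congrFun h1 i) j
    simp only [Matrix.transpose_apply, Matrix.smul_apply, Matrix.neg_apply, smul_eq_mul] at this ⊢
    apply mul_left_cancel₀ hc
    rw [this]; ring
  · have := h2 i
    simpa [hc] using this

variable (Q : Matrix n n R) (hQ : Qᵀ = Q) (k : n)

/-- second order adjugate -/
def Bmat (k : n) : Matrix n n R := (Q + Matrix.single k k 1).adjugate - Q.adjugate

include hQ
lemma adj_symm : Q.adjugateᵀ = Q.adjugate := by
  rw [Matrix.adjugate_transpose, hQ]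

lemma B_symm : (Bmat Q k)ᵀ = Bmat Q k := by
  unfold Bmat
  rw [Matrix.transpose_sub, Matrix.adjugate_transpose, Matrix.adjugate_transpose, Matrix.transpose_add, hQ,
    Matrix.transpose_single]

omit hQ in
lemma upd_eq : Q + Matrix.single k k 1 = Q.updateRow k (Q k + Pi.single k 1) := by
  ext i j
  by_cases hi : i = k
  · subst hi
    by_cases hj : j = i
    · subst hj; simp
    · simp [Matrix.single_apply, Pi.single_apply, hj, Ne.symm hj]
  · simp [Matrix.updateRow_ne hi, Matrix.single_apply, Ne.symm hi]

omit hQ in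
lemma det_upd : (Q + Matrix.single k k 1).det = Q.det + Q.adjugate k k := by
  rw [upd_eq, Matrix.det_updateRow_add, Matrix.updateRow_eq_self, Matrix.adjugate_apply]

omit hQ in
lemma B_col (i : n) : Bmat Q k i k = 0 := by
  unfold Bmat
  rw [Matrix.sub_apply, Matrix.adjugate_apply, Matrix.adjugate_apply, upd_eq, Matrix.updateRow_idem, sub_self]

lemma B_row (i : n) : Bmat Q k k i = 0 := by
  rw [← B_symm Q hQ k]; exact B_col Q k i

lemma S_B : Matrix.single k k 1 * Bmat Q k = 0 := by
  ext i j
  by_cases hi : i = k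
  · subst hi; rw [Matrix.single_mul_apply_same, B_row Q hQ]; simp
  · rw [Matrix.single_mul_apply_of_ne _ _ _ _ _ hi]; simp

lemma Q_B : Q * Bmat Q k = Q.adjugate k k • (1 : Matrix n n R) - Matrix.single k k 1 * Q.adjugate := by
  have h1 := Matrix.mul_adjugate (Q + Matrix.single k k 1)
  have h2 : (Q + Matrix.single k k 1).adjugate = Bmat Q k + Q.adjugate := by simp [Bmat]
  rw [h2, det_upd, Matrix.add_mul, Matrix.mul_add, Matrix.mul_add, S_B Q hQ k, Matrix.mul_adjugate, add_smul] at h1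
  have h3 : Q * Bmat Q k + Matrix.single k k 1 * Q.adjugate = Q.adjugate k k • (1 : Matrix n n R) := by
    have h4 := congrArg (fun X => X - Q.det • (1 : Matrix n n R)) h1
    rw [add_sub_cancel_left] at h4
    rw [← h4]; abel
  rw [← h3]; abel

lemma B_Q : Bmat Q k * Q = Q.adjugate k k • (1 : Matrix n n R) - Q.adjugate * Matrix.single k k 1 := by
  have h := congrArg Matrix.transpose (Q_B Q hQ k)
  rw [Matrix.transpose_mul, B_symm Q hQ, hQ, Matrix.transpose_sub, Matrix.transpose_mul, adj_symm Q hQ,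
    Matrix.transpose_single, Matrix.transpose_smul, Matrix.transpose_one] at h
  exact h

lemma det_B : Q.det • Bmat Q k = Q.adjugate k k • Q.adjugate
    - Q.adjugate * Matrix.single k k 1 * Q.adjugate := by
  have h := congrArg (fun X => Q.adjugate * X) (Q_B Q hQ k)
  beta_reduce at h
  rw [← Matrix.mul_assoc, Matrix.adjugate_mul, Matrix.smul_mul, Matrix.one_mul, Matrix.mul_sub,
    Matrix.mul_smul, Matrix.mul_one, ← Matrix.mul_assoc] at h
  exact h

omit hQ in
lemma SXS (X : Matrix n n R) : Matrix.single k k 1 * X * Matrix.single k k 1 = X k k • Matrix.single k k (1:R) := by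
  rw [Matrix.single_mul_mul_single, Matrix.smul_single]
  simp

/-- 2x2 minors of the adjugate -/
lemma adj_sq (l : n) : Q.adjugate k l ^ 2 = Q.adjugate k k * Q.adjugate l l - Q.det * Bmat Q k l l := by
  have h := congrArg (fun X : Matrix n n R => X l l) (det_B Q hQ k)
  beta_reduce at h
  have h2 : Q.adjugate l k = Q.adjugate k l := congrFun (congrFun (adj_symm Q hQ) k) l
  have h3 : (Q.adjugate * Matrix.single k k 1 * Q.adjugate : Matrix n n R) l l = Q.adjugate k l ^ 2 := by
    rw [Matrix.mul_assoc, Matrix.mul_apply, Finset.sum_eq_single k]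
    · rw [Matrix.single_mul_apply_same, h2]; ring
    · intro b _ hb
      rw [Matrix.single_mul_apply_of_ne _ _ _ _ _ hb, mul_zero]
    · simp
  rw [Matrix.smul_apply, Matrix.sub_apply, h3, Matrix.smul_apply, smul_eq_mul, smul_eq_mul] at h
  linear_combination h

variable (hd : Q.det ≠ 0)

lemma h2_det {Z : Matrix n n R} (hN : Q * Z ∈ Alt R n) :
    ∃ M ∈ Alt R n, Q.det ^ 2 • Z = M * Q := by
  refine ⟨Q.adjugate * (Q * Z) * Q.adjugate, ?_, ?_⟩
  · have := alt_conj Q.adjugate hN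
    rwa [adj_symm Q hQ] at this
  · rw [← Matrix.mul_assoc, Matrix.adjugate_mul, Matrix.mul_assoc _ _ Q, Matrix.adjugate_mul, pow_two, mul_smul]
    simp

omit hQ in
lemma h1_det {Y : Matrix n n R} (hY : (Q.adjugate * Y).trace = 0) :
    ∃ Z : Matrix n n R, Z.trace = 0 ∧ ∃ N ∈ Alt R n, Q.det ^ 2 • Y = Q * Z + N := by
  refine ⟨Q.det • (Q.adjugate * Y), by rw [Matrix.trace_smul, hY, smul_zero], 0, zero_mem _, ?_⟩
  rw [Matrix.mul_smul, ← Matrix.mul_assoc, Matrix.mul_adjugate, pow_two, mul_smul]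
  simp

include hd

lemma h2_adj {Z : Matrix n n R} (hN : Q * Z ∈ Alt R n) :
    ∃ M ∈ Alt R n, Q.adjugate k k ^ 2 • Z = M * Q := by
  set A := Q.adjugate with hA
  set B := Bmat Q k with hB
  set S : Matrix n n R := Matrix.single k k 1 with hS
  have hAs : Aᵀ = A := adj_symm Q hQ
  have hBs : Bᵀ = B := B_symm Q hQ k
  have hSs : Sᵀ = S := by rw [hS, Matrix.transpose_single]
  have hZA : Z * A ∈ Alt R n := by
    apply alt_of_smul hd
    have := alt_conj A hN
    rwa [hAs, ← Matrix.mul_assoc, Matrix.adjugate_mul, Matrix.smul_mul, Matrix.one_mul, Matrix.smul_mul] at this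
  have hAZ : A * Zᵀ = - (Z * A) := by
    have := hZA.1
    rwa [Matrix.transpose_mul, hAs] at this
  refine ⟨B * (Q * Z) * B + (A * S * Z * B - (A * S * Z * B)ᵀ), ?_, ?_⟩
  · refine add_mem ?_ (alt_sub _)
    have := alt_conj B hN
    rwa [hBs] at this
  · have hBQ : B * Q = A k k • (1 : Matrix n n R) - A * S := B_Q Q hQ k
    have hAQ : A * Q = Q.det • (1 : Matrix n n R) := Matrix.adjugate_mul Q
    have hdB : Q.det • B = A k k • A - A * S * A := det_B Q hQ k
    have e1 : B * (Q * Z) * B * Q = (A k k • (1 : Matrix n n R) - A * S) * Z * (A k k • (1 : Matrix n n R) - A * S) := by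
      rw [← Matrix.mul_assoc, hBQ, Matrix.mul_assoc _ B Q, hBQ]
    have e2 : A * S * Z * B * Q = A * S * Z * (A k k • (1 : Matrix n n R) - A * S) := by
      rw [Matrix.mul_assoc _ B Q, hBQ]
    have e3 : (A * S * Z * B)ᵀ * Q = - (A k k • (Z * A * S)) := by
      have t : (A * S * Z * B)ᵀ = B * Zᵀ * S * A := by
        simp only [Matrix.transpose_mul, hAs, hBs, hSs, Matrix.mul_assoc]
      rw [t, Matrix.mul_assoc _ A Q, hAQ, Matrix.mul_smul, Matrix.mul_one, ← Matrix.smul_mul, ← Matrix.smul_mul,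
        hdB, Matrix.sub_mul, Matrix.sub_mul, Matrix.smul_mul, hAZ, Matrix.mul_assoc (A * S) A, hAZ]
      have t2 : A * S * -(Z * A) * S = - (A * (S * (Z * A) * S)) := by
        simp only [Matrix.mul_neg, Matrix.neg_mul, Matrix.mul_assoc]
      rw [t2, SXS, hZA.2 k]
      simp
    rw [Matrix.add_mul, Matrix.sub_mul, e1, e2, e3]
    simp only [Matrix.sub_mul, Matrix.mul_sub, Matrix.smul_mul, Matrix.mul_smul, Matrix.one_mul, Matrix.mul_one, pow_two, mul_smul, smul_sub, Matrix.mul_assoc]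
    abel

omit hd in
lemma h1_adj {Y : Matrix n n R} (hY : (Q.adjugate * Y).trace = 0) :
    ∃ Z : Matrix n n R, Z.trace = 0 ∧ ∃ N ∈ Alt R n, Q.adjugate k k ^ 2 • Y = Q * Z + N := by
  set A := Q.adjugate with hA
  set B := Bmat Q k with hB
  set S : Matrix n n R := Matrix.single k k 1 with hS
  have hAs : Aᵀ = A := adj_symm Q hQ
  have hBs : Bᵀ = B := B_symm Q hQ k
  have hSs : Sᵀ = S := by rw [hS, Matrix.transpose_single]
  have hSB : S * B = 0 := S_B Q hQ k
  have hQB : Q * B = A k k • (1 : Matrix n n R) - S * A := Q_B Q hQ k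
  have hQA : Q * A = Q.det • (1 : Matrix n n R) := Matrix.mul_adjugate Q
  have hdB : Q.det • B = A k k • A - A * S * A := det_B Q hQ k
  have hAS : (A * S).trace = A k k := by
    rw [Matrix.trace_mul_comm, hS]; simp [Matrix.trace_single_mul]
  refine ⟨A k k • (B * Y) + B * Yᵀ * A * S - (Y * B).trace • (A * S), ?_,
    A k k • (S * A * Y - (S * A * Y)ᵀ), Submodule.smul_mem _ _ (alt_sub _), ?_⟩
  · have e1 : (B * Yᵀ * A * S).trace = 0 := by
      rw [Matrix.trace_mul_comm, ← Matrix.mul_assoc, ← Matrix.mul_assoc, hSB]; simp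
    rw [Matrix.trace_sub, Matrix.trace_add, Matrix.trace_smul, Matrix.trace_smul, e1, hAS,
      Matrix.trace_mul_comm B Y]
    simp only [smul_eq_mul]; ring
  · have e1 : Q * (B * Y) = A k k • Y - S * A * Y := by
      rw [← Matrix.mul_assoc, hQB, Matrix.sub_mul, Matrix.smul_mul, Matrix.one_mul]
    have e2 : Q * (B * Yᵀ * A * S) = A k k • (Yᵀ * A * S) - (A * Yᵀ * A) k k • S := by
      rw [← SXS k (A * Yᵀ * A)]
      simp only [← Matrix.mul_assoc]
      rw [hQB]
      simp only [Matrix.sub_mul, Matrix.smul_mul, Matrix.one_mul, hS]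
    have e3 : Q * (A * S) = Q.det • S := by
      rw [← Matrix.mul_assoc, hQA]; simp
    have e4 : Q.det * (Y * B).trace = - (A * Yᵀ * A) k k := by
      rw [← smul_eq_mul, ← Matrix.trace_smul, ← Matrix.mul_smul, hdB, Matrix.mul_sub, Matrix.trace_sub,
        Matrix.mul_smul, Matrix.trace_smul, Matrix.trace_mul_comm Y A, hY, smul_zero, zero_sub]
      congr 1
      rw [Matrix.trace_mul_comm, Matrix.mul_assoc, Matrix.mul_assoc, Matrix.trace_mul_comm, Matrix.mul_assoc,
        hS, Matrix.trace_single_mul]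
      have : (A * Y * A)ᵀ = A * Yᵀ * A := by
        simp only [Matrix.transpose_mul, hAs, Matrix.mul_assoc]
      rw [← this]
      simp
    have e5 : (S * A * Y)ᵀ = Yᵀ * A * S := by
      simp only [Matrix.transpose_mul, hAs, hSs, Matrix.mul_assoc]
    rw [Matrix.mul_sub, Matrix.mul_add, Matrix.mul_smul, e1, e2, Matrix.mul_smul, e3, smul_smul,
      mul_comm _ Q.det, e4, e5]
    simp only [pow_two, mul_smul, smul_sub, neg_smul]
    abel
end mat
end Config

open scoped BigOperators
set_option linter.unusedSectionVars false
namespace Config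
section rmod
open RingTheory.Sequence
variable {R : Type} [CommRing R]

/-- elementwise regularity of a length three sequence on a module -/
def RM (a b c : R) (M : Type) [AddCommGroup M] [Module R M] : Prop :=
  (∀ x : M, a • x = 0 → x = 0) ∧ (∀ x y : M, b • x = a • y → ∃ z, x = a • z) ∧
  (∀ x y z : M, c • x = a • y + b • z → ∃ u v : M, x = a • u + b • v)

variable {a b c : R} {M F1 F2 F3 : Type} [AddCommGroup M] [Module R M]
  [AddCommGroup F1] [Module R F1] [AddCommGroup F2] [Module R F2] [AddCommGroup F3] [Module R F3]

lemma RM.retract (s : F1 →ₗ[R] F2) (t : F2 →ₗ[R] F1) (hst : ∀ x, t (s x) = x) (h : RM a b c F2) :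
    RM a b c F1 := by
  obtain ⟨h1, h2, h3⟩ := h
  refine ⟨fun x hx => ?_, fun x y hxy => ?_, fun x y z hxy => ?_⟩
  · rw [← hst x, h1 (s x) (by rw [← map_smul, hx, map_zero]), map_zero]
  · obtain ⟨z, hz⟩ := h2 (s x) (s y) (by rw [← map_smul, hxy, map_smul])
    exact ⟨t z, by rw [← map_smul, ← hz, hst]⟩
  · obtain ⟨u, v, hz⟩ := h3 (s x) (s y) (s z) (by rw [← map_smul, hxy, map_add, map_smul, map_smul])
    exact ⟨t u, t v, by rw [← map_smul, ← map_smul, ← map_add, ← hz, hst]⟩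

lemma RM.pi (ι : Type) (h : RM a b c R) : RM a b c (ι → R) := by
  obtain ⟨h1, h2, h3⟩ := h
  refine ⟨fun x hx => ?_, fun x y hxy => ?_, fun x y z hxy => ?_⟩
  · funext i; exact h1 _ (congrFun hx i)
  · choose z hz using fun i => h2 (x i) (y i) (congrFun hxy i)
    exact ⟨z, funext hz⟩
  · choose u v hz using fun i => h3 (x i) (y i) (z i) (congrFun hxy i)
    exact ⟨u, v, funext hz⟩

lemma RM.prod (h : RM a b c F1) (h' : RM a b c F2) : RM a b c (F1 × F2) := by
  obtain ⟨h1, h2, h3⟩ := h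
  obtain ⟨h1', h2', h3'⟩ := h'
  refine ⟨fun x hx => ?_, fun x y hxy => ?_, fun x y z hxy => ?_⟩
  · exact Prod.ext (h1 _ (congrArg Prod.fst hx)) (h1' _ (congrArg Prod.snd hx))
  · obtain ⟨z, hz⟩ := h2 x.1 y.1 (congrArg Prod.fst hxy)
    obtain ⟨z', hz'⟩ := h2' x.2 y.2 (congrArg Prod.snd hxy)
    exact ⟨(z, z'), Prod.ext hz hz'⟩
  · obtain ⟨u, v, hz⟩ := h3 x.1 y.1 z.1 (congrArg Prod.fst hxy)
    obtain ⟨u', v', hz'⟩ := h3' x.2 y.2 z.2 (congrArg Prod.snd hxy)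
    exact ⟨(u, u'), (v, v'), Prod.ext hz hz'⟩

lemma wr_iff (rs : List R) : IsWeaklyRegular R rs ↔
    ∀ (i : ℕ) (h : i < rs.length), ∀ y : R, y * rs.get ⟨i, h⟩ ∈ Ideal.ofList (rs.take i) →
      y ∈ Ideal.ofList (rs.take i) := by
  constructor
  · intro h i hi y hy
    have := h.regular_mod_prev i hi
    rw [isSMulRegular_iff_right_eq_zero_of_smul] at this
    have h2 := this (Submodule.Quotient.mk y) (by
      rw [← Submodule.Quotient.mk_smul, Submodule.Quotient.mk_eq_zero]
      simp only [smul_eq_mul, Ideal.mul_top]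
      rw [mul_comm]; exact hy)
    rw [Submodule.Quotient.mk_eq_zero] at h2
    simpa only [smul_eq_mul, Ideal.mul_top] using h2
  · intro h
    refine ⟨fun i hi => ?_⟩
    rw [isSMulRegular_iff_right_eq_zero_of_smul]
    intro x hx
    obtain ⟨x, rfl⟩ := Submodule.mkQ_surjective _ x
    rw [← map_smul, Submodule.mkQ_apply, Submodule.Quotient.mk_eq_zero] at hx
    rw [Submodule.mkQ_apply, Submodule.Quotient.mk_eq_zero]
    simp only [smul_eq_mul, Ideal.mul_top] at hx ⊢
    exact h i hi x (by rw [mul_comm]; exact hx)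

lemma RM.of_wr (h : IsWeaklyRegular R [a, b, c]) : RM a b c R := by
  rw [wr_iff] at h
  refine ⟨fun x hx => ?_, fun x y hxy => ?_, fun x y z hxy => ?_⟩
  · have := h 0 (by simp) x (by simpa [mul_comm] using hx)
    simpa using this
  · have := h 1 (by simp) x (by
      simp [Ideal.ofList_singleton, Ideal.mem_span_singleton']
      exact ⟨y, by simp only [smul_eq_mul] at hxy; linear_combination -hxy⟩)
    simp only [List.take_succ_cons, List.take_zero, Ideal.ofList_singleton,
      Ideal.mem_span_singleton'] at this
    obtain ⟨z, hz⟩ := this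
    exact ⟨z, by rw [← hz, smul_eq_mul, mul_comm]⟩
  · have e : Ideal.ofList [a, b] = Ideal.span {a, b} := by
      rw [Ideal.ofList]; congr 1; ext x; simp
    have := h 2 (by simp) x (by
      simp only [List.take_succ_cons, List.take_zero, e]
      rw [Ideal.mem_span_pair]
      exact ⟨y, z, by simp only [smul_eq_mul] at hxy; simp; linear_combination -hxy⟩)
    simp only [List.take_succ_cons, List.take_zero, e] at this
    rw [Ideal.mem_span_pair] at this
    obtain ⟨u, v, hz⟩ := this
    exact ⟨u, v, by rw [← hz, smul_eq_mul, smul_eq_mul]; ring⟩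

lemma exact2 (d3 : F3 →ₗ[R] F2) (d2 : F2 →ₗ[R] F1) (hi : Function.Injective d3) (h3 : RM a b c F3)
    (h2 : RM a b c F2) (ha : ∀ z, d2 z = 0 → ∃ y, a • z = d3 y) (hb : ∀ z, d2 z = 0 → ∃ y, b • z = d3 y)
    (z : F2) (hz : d2 z = 0) : ∃ y, z = d3 y := by
  obtain ⟨y, hy⟩ := ha z hz
  obtain ⟨y', hy'⟩ := hb z hz
  have e : b • y = a • y' := by
    apply hi
    rw [map_smul, map_smul, ← hy, ← hy', smul_comm]
  obtain ⟨y2, hy2⟩ := h3.2.1 _ _ e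
  refine ⟨y2, ?_⟩
  rw [← sub_eq_zero]
  apply h2.1
  rw [smul_sub, hy, hy2, map_smul, sub_self]

lemma exact1 (d3 : F3 →ₗ[R] F2) (d2 : F2 →ₗ[R] F1) (d1 : F1 →ₗ[R] M) (hi : Function.Injective d3)
    (h3 : RM a b c F3) (h2 : RM a b c F2) (h1 : RM a b c F1)
    (h23 : ∀ y, d2 (d3 y) = 0)
    (hex : ∀ z, d2 z = 0 → ∃ y, z = d3 y)
    (ha : ∀ z, d1 z = 0 → ∃ y, a • z = d2 y) (hb : ∀ z, d1 z = 0 → ∃ y, b • z = d2 y)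
    (hc : ∀ z, d1 z = 0 → ∃ y, c • z = d2 y)
    (z : F1) (hz : d1 z = 0) : ∃ y, z = d2 y := by
  obtain ⟨y1, e1⟩ := ha z hz
  obtain ⟨y2, e2⟩ := hb z hz
  obtain ⟨y3, e3⟩ := hc z hz
  obtain ⟨w12, e12⟩ := hex (b • y1 - a • y2) (by
    rw [map_sub, map_smul, map_smul, ← e1, ← e2, smul_comm, sub_self])
  obtain ⟨w13, e13⟩ := hex (c • y1 - a • y3) (by
    rw [map_sub, map_smul, map_smul, ← e1, ← e3, smul_comm, sub_self])
  obtain ⟨w23, e23⟩ := hex (c • y2 - b • y3) (by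
    rw [map_sub, map_smul, map_smul, ← e2, ← e3, smul_comm, sub_self])
  have e : c • w12 = a • (-w23) + b • w13 := by
    apply hi
    rw [map_add, map_smul, map_smul, map_smul, map_neg, ← e12, ← e13, ← e23]
    module
  obtain ⟨u, v, huv⟩ := h3.2.2 _ _ _ e
  obtain ⟨y4, e4⟩ := h2.2.1 (y1 - d3 v) (y2 + d3 u) (by
    rw [huv, map_add, map_smul, map_smul] at e12
    rw [smul_sub, smul_add, sub_eq_iff_eq_add]
    rw [sub_eq_iff_eq_add] at e12
    rw [e12]; abel)
  refine ⟨y4, ?_⟩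
  rw [← sub_eq_zero]
  apply h1.1
  rw [smul_sub, e1, ← map_smul, ← e4, map_sub, h23, sub_zero, sub_self]
end rmod

section res
open Matrix RingTheory.Sequence
variable {R : Type} [CommRing R] {n : Type} [Fintype n] [DecidableEq n] [LinearOrder n]

/-- trace zero matrices -/
abbrev Sl (R : Type) [CommRing R] (n : Type) [Fintype n] : Submodule R (Matrix n n R) :=
  LinearMap.ker (Matrix.traceLinearMap n R R)

/-- retraction to trace zero matrices -/
def slRetr (k : n) : Matrix n n R →ₗ[R] Sl R n :=
  LinearMap.codRestrict (Sl R n)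
    (LinearMap.id - (LinearMap.toSpanSingleton R (Matrix n n R) (Matrix.single k k 1)) ∘ₗ
      Matrix.traceLinearMap n R R)
    (fun Y => by simp)

lemma slRetr_apply (k : n) (Z : Sl R n) : slRetr k (Z : Matrix n n R) = Z := by
  apply Subtype.ext
  have : (Z : Matrix n n R).trace = 0 := Z.2
  simp [slRetr, this]

variable (Q : Matrix n n R) (hQ : Qᵀ = Q)

/-- first differential -/
def d1 : Matrix n n R →ₗ[R] R := Matrix.traceLinearMap n R R ∘ₗ LinearMap.mulLeft R Q.adjugate

/-- second differential -/
def d2 : Sl R n × Alt R n →ₗ[R] Matrix n n R :=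
  (LinearMap.mulLeft R Q ∘ₗ (Sl R n).subtype).coprod (Alt R n).subtype

lemma d2_apply (x : Sl R n × Alt R n) : d2 Q x = Q * (x.1 : Matrix n n R) + (x.2 : Matrix n n R) := rfl

/-- third differential -/
def d3 : Alt R n →ₗ[R] Sl R n × Alt R n :=
  LinearMap.prod
    (LinearMap.codRestrict (Sl R n) (LinearMap.mulRight R Q ∘ₗ (Alt R n).subtype)
      (fun N => by
        show ((N : Matrix n n R) * Q).trace = 0
        rw [Matrix.trace_mul_comm]; exact trace_sym_alt hQ N.2))
    (LinearMap.codRestrict (Alt R n)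
      (- (LinearMap.mulLeft R Q ∘ₗ LinearMap.mulRight R Q ∘ₗ (Alt R n).subtype))
      (fun N => by
        have := alt_conj Q N.2
        rw [hQ] at this
        refine neg_mem ?_
        show Q * ((N : Matrix n n R) * Q) ∈ _
        rwa [← Matrix.mul_assoc]))

lemma d3_fst (N : Alt R n) : ((d3 Q hQ N).1 : Matrix n n R) = N * Q := rfl
lemma d3_snd (N : Alt R n) : ((d3 Q hQ N).2 : Matrix n n R) = - (Q * (N * Q)) := rfl

variable [IsDomain R] (hd : Q.det ≠ 0)
include hd

lemma d3_inj : Function.Injective (d3 Q hQ) := by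
  rw [injective_iff_map_eq_zero]
  intro N hN
  have h1 : (N : Matrix n n R) * Q = 0 := by rw [← d3_fst Q hQ, hN]; rfl
  have h2 : Q.det • (N : Matrix n n R) = 0 := by
    rw [← Matrix.mul_one (N : Matrix n n R), ← Matrix.mul_smul, ← Matrix.mul_adjugate, ← Matrix.mul_assoc, h1,
      Matrix.zero_mul]
  apply Subtype.ext
  exact (smul_eq_zero.mp h2).resolve_left hd

/-- the killers of the second homology -/
lemma kill2 {s : R} (hs : s ∈ Ideal.span ({Q.det ^ 2} ∪ Set.range fun k => Q.adjugate k k ^ 2))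
    (z : Sl R n × Alt R n) (hz : d2 Q z = 0) : ∃ y, s • z = d3 Q hQ y := by
  have hN : Q * (z.1 : Matrix n n R) ∈ Alt R n := by
    rw [d2_apply, add_eq_zero_iff_eq_neg] at hz
    rw [hz]; exact neg_mem z.2.2
  have key : ∀ s : R, (∃ M ∈ Alt R n, s • (z.1 : Matrix n n R) = M * Q) → ∃ y, s • z = d3 Q hQ y := by
    rintro s ⟨M, hM, h⟩
    refine ⟨⟨M, hM⟩, Prod.ext (Subtype.ext h) (Subtype.ext ?_)⟩
    rw [d3_snd]
    rw [d2_apply, add_eq_zero_iff_neg_eq] at hz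
    show s • (z.2 : Matrix n n R) = - (Q * (M * Q))
    rw [← h, ← hz, Matrix.mul_smul, smul_neg]
  induction hs using Submodule.span_induction with
  | mem s hs =>
    apply key
    rcases hs with rfl | ⟨k, rfl⟩
    · exact h2_det Q hQ hN
    · exact h2_adj Q hQ k hd hN
  | zero => exact ⟨0, by simp⟩
  | add x y _ _ hx hy =>
    obtain ⟨u, hu⟩ := hx
    obtain ⟨v, hv⟩ := hy
    exact ⟨u + v, by rw [add_smul, hu, hv, map_add]⟩
  | smul t x _ hx =>
    obtain ⟨u, hu⟩ := hx
    exact ⟨t • u, by rw [map_smul, ← hu, smul_eq_mul, mul_smul]⟩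

include hQ
omit hd in
lemma kill1 {s : R} (hs : s ∈ Ideal.span ({Q.det ^ 2} ∪ Set.range fun k => Q.adjugate k k ^ 2))
    (Y : Matrix n n R) (hY : d1 Q Y = 0) : ∃ y, s • Y = d2 Q y := by
  have key : ∀ s : R, (∃ Z : Matrix n n R, Z.trace = 0 ∧ ∃ N ∈ Alt R n, s • Y = Q * Z + N) →
      ∃ y, s • Y = d2 Q y := by
    rintro s ⟨Z, hZ, N, hN, h⟩
    exact ⟨(⟨Z, hZ⟩, ⟨N, hN⟩), h⟩
  induction hs using Submodule.span_induction with
  | mem s hs =>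
    apply key
    rcases hs with rfl | ⟨k, rfl⟩
    · exact h1_det Q hY
    · exact h1_adj Q hQ k hY
  | zero => exact ⟨0, by simp⟩
  | add x y _ _ hx hy =>
    obtain ⟨u, hu⟩ := hx
    obtain ⟨v, hv⟩ := hy
    exact ⟨u + v, by rw [add_smul, hu, hv, map_add]⟩
  | smul t x _ hx =>
    obtain ⟨u, hu⟩ := hx
    exact ⟨t • u, by rw [map_smul, ← hu, smul_eq_mul, mul_smul]⟩

omit hd in
lemma d2_d3 (N : Alt R n) : d2 Q (d3 Q hQ N) = 0 := by
  rw [d2_apply, d3_fst, d3_snd, add_neg_cancel]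

omit hd in
lemma d1_d2 (z : Sl R n × Alt R n) : d1 Q (d2 Q z) = 0 := by
  show (Q.adjugate * d2 Q z).trace = 0
  have : (z.1 : Matrix n n R).trace = 0 := z.1.2
  rw [d2_apply, Matrix.mul_add, ← Matrix.mul_assoc, Matrix.adjugate_mul, Matrix.trace_add,
    trace_sym_alt (adj_symm Q hQ) z.2.2]
  simp [this]

omit hQ hd in
lemma d1_range (I : Ideal R) (hI : I = Ideal.span (Set.range fun p : n × n => Q.adjugate p.1 p.2)) :
    LinearMap.range (d1 Q) = I := by
  subst hI
  apply le_antisymm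
  · rintro _ ⟨Y, rfl⟩
    show (Q.adjugate * Y).trace ∈ _
    rw [Matrix.trace]
    refine sum_mem fun i _ => ?_
    rw [Matrix.diag_apply, Matrix.mul_apply]
    refine sum_mem fun j _ => Ideal.mul_mem_right _ _ (Ideal.subset_span ⟨(i, j), rfl⟩)
  · rw [Ideal.span_le]
    rintro _ ⟨⟨i, j⟩, rfl⟩
    refine ⟨Matrix.single j i 1, ?_⟩
    show (Q.adjugate * Matrix.single j i 1).trace = _
    rw [Matrix.trace_mul_comm, Matrix.trace_single_mul]
    simp

include hd
/-- depth estimate from the resolution -/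
theorem EV_minor [IsNoetherianRing R] (hG : GG R) [Nonempty n] (I : Ideal R)
    (hI : I = Ideal.span (Set.range fun p : n × n => Q.adjugate p.1 p.2))
    (hht : ∀ P : Ideal R, P.IsPrime → I ≤ P → (3 : ℕ∞) ≤ P.height)
    (N : Type) [AddCommGroup N] [Module R N] (m : ℕ) (h : EV R N R (m + 3)) : EV R N (R ⧸ I) m := by
  obtain ⟨k0⟩ := ‹Nonempty n›
  obtain ⟨rs, hl, hm, hreg⟩ := hG.exists_seq
    (Ideal.span ({Q.det ^ 2} ∪ Set.range fun k => Q.adjugate k k ^ 2)) 3 (by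
      intro P hP hJ
      refine hht P hP ?_
      rw [hI, Ideal.span_le]
      rintro _ ⟨⟨i, j⟩, rfl⟩
      have hd' : Q.det ∈ P := hP.mem_of_pow_mem 2 (hJ (Ideal.subset_span (Or.inl rfl)))
      have hk : ∀ k, Q.adjugate k k ∈ P := fun k =>
        hP.mem_of_pow_mem 2 (hJ (Ideal.subset_span (Or.inr ⟨k, rfl⟩)))
      apply hP.mem_of_pow_mem 2
      rw [adj_sq Q hQ]
      exact sub_mem (Ideal.mul_mem_right _ _ (hk i)) (Ideal.mul_mem_right _ _ hd'))
  obtain ⟨a, b, c, rfl⟩ := List.length_eq_three.mp hl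
  have hR : RM a b c R := RM.of_wr hreg
  let cur : Matrix n n R ≃ₗ[R] (n × n → R) := (LinearEquiv.curry R R n n).symm
  have hM : RM a b c (Matrix n n R) :=
    RM.retract cur.toLinearMap cur.symm.toLinearMap (fun x => by simp) (RM.pi (n × n) hR)
  have hAlt : RM a b c (Alt R n) := RM.retract (Alt R n).subtype altRetr altRetr_apply hM
  have hSl : RM a b c (Sl R n) := RM.retract (Sl R n).subtype (slRetr k0) (slRetr_apply k0) hM
  have hex2 : ∀ z, d2 Q z = 0 → ∃ y, z = d3 Q hQ y :=
    exact2 (d3 Q hQ) (d2 Q) (d3_inj Q hQ hd) hAlt (hSl.prod hAlt) (kill2 Q hQ hd (hm a (by simp)))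
      (kill2 Q hQ hd (hm b (by simp)))
  have hex1 : ∀ z, d1 Q z = 0 → ∃ y, z = d2 Q y :=
    exact1 (d3 Q hQ) (d2 Q) (d1 Q) (d3_inj Q hQ hd) hAlt (hSl.prod hAlt) hM (d2_d3 Q hQ) hex2
      (kill1 Q hQ (hm a (by simp))) (kill1 Q hQ (hm b (by simp))) (kill1 Q hQ (hm c (by simp)))
  have vM : EV R N (Matrix n n R) (m + 3) :=
    EV.retract cur.toLinearMap cur.symm.toLinearMap (fun x => by simp) _ (EV.fintype _ h)
  have vAlt : EV R N (Alt R n) (m + 3) := EV.retract (Alt R n).subtype altRetr altRetr_apply _ vM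
  have vSl : EV R N (Sl R n) (m + 3) := EV.retract (Sl R n).subtype (slRetr k0) (slRetr_apply k0) _ vM
  have vP : EV R N (Sl R n × Alt R n) (m + 3) :=
    EV.ses2 (LinearMap.inl R (Sl R n) (Alt R n)) (LinearMap.snd R (Sl R n) (Alt R n)) LinearMap.inl_injective
      LinearMap.snd_surjective .inl_snd _ vSl vAlt
  have vK : EV R N (LinearMap.ker (d1 Q)) (m + 2) := by
    refine EV.ses3 (d3 Q hQ) (LinearMap.codRestrict (LinearMap.ker (d1 Q)) (d2 Q) (d1_d2 Q hQ))
      (d3_inj Q hQ hd) ?_ ?_ _ vAlt (vP.mono (by omega))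
    · rintro ⟨Y, hY⟩
      obtain ⟨y, hy⟩ := hex1 Y hY
      exact ⟨y, Subtype.ext hy.symm⟩
    · intro z
      constructor
      · intro hz
        obtain ⟨y, hy⟩ := hex2 z (congrArg Subtype.val hz)
        exact ⟨y, hy.symm⟩
      · rintro ⟨y, rfl⟩
        exact Subtype.ext (d2_d3 Q hQ y)
  have hr := d1_range Q I hI
  have vI : EV R N I (m + 1) := by
    refine EV.ses3 (LinearMap.ker (d1 Q)).subtype
      (LinearMap.codRestrict I (d1 Q) (fun x => by rw [← hr]; exact ⟨x, rfl⟩))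
      Subtype.val_injective ?_ ?_ _ vK (vM.mono (by omega))
    · rintro ⟨y, hy⟩
      rw [← hr] at hy
      obtain ⟨x, hx⟩ := hy
      exact ⟨x, Subtype.ext hx⟩
    · intro z
      constructor
      · intro hz
        exact ⟨⟨z, congrArg Subtype.val hz⟩, rfl⟩
      · rintro ⟨y, rfl⟩
        exact Subtype.ext y.2
  exact EV.ses3 (I.subtype) (Submodule.mkQ I) Subtype.val_injective (Submodule.mkQ_surjective _)
    (LinearMap.exact_subtype_mkQ I) _ vI (h.mono (by omega))
end res
end Config

open scoped BigOperators
set_option linter.unusedSectionVars false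
namespace Config
section concl
open RingTheory.Sequence
variable {R : Type} [CommRing R] [IsNoetherianRing R] (hG : GG R) (I : Ideal R)
  (hEV : ∀ (N : Type) [AddCommGroup N] [Module R N] (m : ℕ), EV R N R (m + 3) → EV R N (R ⧸ I) m)
  (hht : ∀ P : Ideal R, P.IsPrime → I ≤ P → (3 : ℕ∞) ≤ P.height)

lemma ht_nat (P : Ideal R) (hP : P.IsPrime) : ∃ n : ℕ, P.height = n := by
  have : P.height ≠ ⊤ := Ideal.height_ne_top hP.ne_top
  exact ⟨P.height.toNat, (ENat.natCast_toNat this).symm⟩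

lemma htP_eq (P : Ideal R) (hP : P.IsPrime) : htP P hP = P.height :=
  (PrimeSpectrum.height_eq_orderHeight (⟨P, hP⟩ : PrimeSpectrum R)).symm

include hG hEV hht in
lemma min_ht (p : Ideal R) (hp : p ∈ I.minimalPrimes) : p.height = 3 := by
  have hpp : p.IsPrime := hp.1.1
  obtain ⟨n, hn⟩ := ht_nat p hpp
  have h3 := hht p hpp hp.1.2
  rw [hn] at h3 ⊢
  have h3' : 3 ≤ n := by exact_mod_cast h3
  by_contra hne
  have h4 : 4 ≤ n := by
    rcases Nat.lt_or_ge n 4 with h | h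
    · exact absurd (by have : n = 3 := by omega
                       rw [this]; rfl) hne
    · exact h
  have e := hG.EV p hpp n hn
  have e2 := hEV (R ⧸ p) 1 (e.mono h4)
  refine EV.no_ass p hpp.ne_top e2 ?_
  apply Module.associatedPrimes.minimalPrimes_annihilator_subset_associatedPrimes
  rwa [Ideal.annihilator_quotient]

include hht in
lemma chain_ht : ∀ (k : ℕ) (q : PrimeSpectrum (R ⧸ I)), (k : ℕ∞) ≤ Order.height q →
    ((k + 3 : ℕ) : ℕ∞) ≤ Order.height (PrimeSpectrum.comap (Ideal.Quotient.mk I) q) := by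
  intro k
  induction k with
  | zero =>
    intro q _
    have := hht (PrimeSpectrum.comap (Ideal.Quotient.mk I) q).asIdeal
      (PrimeSpectrum.comap (Ideal.Quotient.mk I) q).isPrime (by
        intro x hx
        show Ideal.Quotient.mk I x ∈ q.asIdeal
        rw [Ideal.Quotient.eq_zero_iff_mem.mpr hx]; exact zero_mem _)
    rw [PrimeSpectrum.height_eq_orderHeight] at this
    simpa using this
  | succ k ih =>
    intro q hq
    have hfin : Order.height q < ⊤ := by
      rw [← PrimeSpectrum.height_eq_orderHeight]
      exact lt_top_iff_ne_top.mpr (Ideal.height_ne_top q.isPrime.ne_top)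
    have hlt : (k : ℕ∞) < Order.height q := lt_of_lt_of_le (by exact_mod_cast Nat.lt_succ_self k) hq
    obtain ⟨q', hlt', hq'⟩ := (Order.coe_lt_height_iff hfin).mp hlt
    have h1 := ih q' hq'.ge
    have h2 : PrimeSpectrum.comap (Ideal.Quotient.mk I) q' < PrimeSpectrum.comap (Ideal.Quotient.mk I) q := by
      rw [← PrimeSpectrum.asIdeal_lt_asIdeal] at hlt' ⊢
      refine lt_of_le_not_ge (Ideal.comap_mono hlt'.le) fun h => ?_
      apply hlt'.not_ge
      intro x hx
      obtain ⟨x, rfl⟩ := Ideal.Quotient.mk_surjective x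
      exact h hx
    have h3 := Order.height_add_one_le h2
    refine le_trans ?_ h3
    refine le_trans ?_ (add_le_add_left h1 1)
    push_cast
    apply le_of_eq; ring

include hht hEV hG in
lemma cm_of : IsCohenMacaulayRing (R ⧸ I) := by
  intro m' hm'
  have hpr := hm'.isPrime
  rw [htP_eq]
  apply le_antisymm
  · refine iSup₂_le fun l hl => ?_
    refine reg_le_height m' l ((wr_iff l).mpr hl.2.2) hl.1
  · let m := m'.comap (Ideal.Quotient.mk I)
    have hm : m.IsPrime := Ideal.comap_isPrime _ _
    obtain ⟨k, hk⟩ := ht_nat m' hpr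
    obtain ⟨n, hn⟩ := ht_nat m hm
    have h1 := chain_ht I hht k ⟨m', hpr⟩ (by rw [← PrimeSpectrum.height_eq_orderHeight]; exact hk.ge)
    rw [← PrimeSpectrum.height_eq_orderHeight] at h1
    have h2 : ((k + 3 : ℕ) : ℕ∞) ≤ n := hn ▸ h1
    have h3 : k + 3 ≤ n := by exact_mod_cast h2
    have e := hEV (R ⧸ m) k ((hG.EV m hm n hn).mono h3)
    have hmm : m.map (algebraMap R (R ⧸ I)) = m' :=
      Ideal.map_comap_of_surjective _ Ideal.Quotient.mk_surjective m'
    obtain ⟨rs, hl, hmem, hreg⟩ := EV.exists_seq m k (by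
      rw [Ideal.smul_top_eq_map, hmm]
      intro h
      apply hpr.ne_top
      rw [eq_top_iff]
      intro x _
      have : x ∈ Submodule.restrictScalars R m' := by rw [h]; trivial
      exact this) e
    have hin : ∀ x ∈ rs.map (algebraMap R (R ⧸ I)), x ∈ m' := by
      intro x hx
      obtain ⟨y, hy, rfl⟩ := List.mem_map.mp hx
      exact hmem y hy
    rw [hk]
    have hlen : (rs.map (algebraMap R (R ⧸ I))).length = k := by simp [hl]
    rw [← hlen]
    refine le_iSup₂_of_le (rs.map (algebraMap R (R ⧸ I))) ⟨hin, ?_, ?_⟩ le_rfl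
    · intro h
      apply hpr.ne_top
      rw [eq_top_iff, ← h, Ideal.span_le]
      exact hin
    · exact (wr_iff _).mp ((isWeaklyRegular_map_algebraMap_iff (R ⧸ I) (R ⧸ I) rs).mpr hreg.toIsWeaklyRegular)

include hht hEV hG in
lemma htI_eq (hI : I ≠ ⊤) : htI I = 3 := by
  apply le_antisymm
  · obtain ⟨p, hp⟩ := Ideal.nonempty_minimalPrimes hI
    have h := min_ht hG I hEV hht p hp
    have := PrimeSpectrum.height_eq_orderHeight (⟨p, hp.1.1⟩ : PrimeSpectrum R)
    exact iInf₂_le_of_le ⟨p, hp.1.1⟩ hp.1.2 (by rw [← this]; exact h.le)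
  · refine le_iInf₂ fun p hp => ?_
    rw [← PrimeSpectrum.height_eq_orderHeight]
    exact hht _ p.isPrime hp
end concl
end Config

open scoped BigOperators
set_option linter.unusedSectionVars false
namespace Config
section deriv
open Matrix
variable {K A : Type} [CommRing K] [CommRing A] [Algebra K A] (D : Derivation K A A)

lemma der_prod {ι : Type} [DecidableEq ι] (s : Finset ι) (f : ι → A) :
    D (∏ i ∈ s, f i) = ∑ i ∈ s, (∏ j ∈ s.erase i, f j) * D (f i) := by
  induction s using Finset.induction_on with
  | empty => simp
  | insert a s ha ih =>
    rw [Finset.prod_insert ha, Derivation.leibniz, ih, Finset.sum_insert ha, Finset.erase_insert ha,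
      smul_eq_mul, smul_eq_mul, Finset.mul_sum, add_comm]
    congr 1
    refine Finset.sum_congr rfl fun i hi => ?_
    have hne : a ≠ i := by rintro rfl; exact ha hi
    rw [Finset.erase_insert_of_ne hne, Finset.prod_insert (by simp [ha])]
    ring

lemma der_det {n : Type} [Fintype n] [DecidableEq n] (M : Matrix n n A) :
    D M.det = ∑ i, ∑ k, M.adjugate i k * D (M k i) := by
  have h1 : ∀ i, ∑ k, M.adjugate i k * D (M k i) = (M.updateCol i fun k => D (M k i)).det := by
    intro i
    rw [← Matrix.cramer_apply, Matrix.cramer_eq_adjugate_mulVec]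
    rfl
  simp only [h1]
  rw [Matrix.det_apply, map_sum]
  simp only [Matrix.det_apply]
  rw [Finset.sum_comm]
  refine Finset.sum_congr rfl fun σ _ => ?_
  rw [← Finset.smul_sum]
  have : D (Equiv.Perm.sign σ • ∏ i, M (σ i) i) = Equiv.Perm.sign σ • D (∏ i, M (σ i) i) := by
    rw [Units.smul_def, map_zsmul, Units.smul_def]
  rw [this, der_prod]
  congr 1
  refine Finset.sum_congr rfl fun i _ => ?_
  rw [← Finset.mul_prod_erase _ _ (Finset.mem_univ i), Matrix.updateCol_self, mul_comm]
  congr 1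
  refine Finset.prod_congr rfl fun j hj => ?_
  rw [Matrix.updateCol_ne (Finset.ne_of_mem_erase hj)]
end deriv

section psi
variable {K : Type} [Field K] {E : Type} [Fintype E] [DecidableEq E]

lemma Qform_symm {r : ℕ} (w : Fin r → E → K) : (Qform w).transpose = Qform w := by
  ext1 i j
  simp only [Qform, Matrix.transpose_apply, Matrix.of_apply]
  exact Finset.sum_congr rfl fun e _ => by rw [mul_comm (w j e)]

lemma det_expand {r : ℕ} (w : Fin r → E → K) : (Qform w).det =
    ∑ φ : Fin r → E, (∏ i, MvPolynomial.C (w i (φ i)) * MvPolynomial.X (φ i)) *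
      MvPolynomial.C (Matrix.det (Matrix.of fun i j : Fin r => w j (φ i))) := by
  have h1 : Qform w = fun i => ∑ e : E, (MvPolynomial.C (w i e) * MvPolynomial.X e : MvPolynomial E K) •
      (fun j => (MvPolynomial.C (w j e) : MvPolynomial E K)) := by
    funext i j
    rw [Finset.sum_apply]
    simp only [Qform, Matrix.of_apply, Pi.smul_apply, smul_eq_mul, map_mul]
    exact Finset.sum_congr rfl fun e _ => by ring
  have h2 : (Qform w).det = (Matrix.detRowAlternating :
    (Fin r → MvPolynomial E K) [⋀^Fin r]→ₗ[MvPolynomial E K] MvPolynomial E K).toMultilinearMap (Qform w) := rfl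
  rw [h2, h1, MultilinearMap.map_sum]
  refine Finset.sum_congr rfl fun φ _ => ?_
  rw [MultilinearMap.map_smul_univ, smul_eq_mul]
  congr 1
  rw [RingHom.map_det]
  rfl

lemma psi_eq_det {r : ℕ} (w : Fin r → E → K) : psi w = (Qform w).det := by
  classical
  rw [det_expand]
  set F : (Fin r → E) → MvPolynomial E K := fun φ =>
    (∏ i, MvPolynomial.C (w i (φ i)) * MvPolynomial.X (φ i)) *
      MvPolynomial.C (Matrix.det (Matrix.of fun i j : Fin r => w j (φ i))) with hF
  have h1 : ∑ φ, F φ = ∑ φ with Function.Injective φ, F φ := by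
    rw [Finset.sum_filter_of_ne]
    intro φ _ hφ
    by_contra hni
    apply hφ
    rw [Function.Injective] at hni
    push Not at hni
    obtain ⟨i, j, hij, hne⟩ := hni
    rw [hF]
    beta_reduce
    rw [Matrix.det_zero_of_row_eq hne (by funext k; simp [hij])]
    simp
  rw [h1, ← Finset.sum_fiberwise_of_maps_to (t := Finset.univ.powersetCard r)
    (g := fun φ => Finset.univ.image φ)]
  · unfold psi
    refine Finset.sum_congr rfl fun B hB => ?_
    have hB' : B.card = r := (Finset.mem_powersetCard.mp hB).2
    set e := Finset.equivFinOfCardEq hB' with he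
    have key : ∑ φ ∈ (Finset.univ.filter fun φ : Fin r → E => Function.Injective φ) with
        Finset.univ.image φ = B, F φ = ∑ σ : Equiv.Perm (Fin r), F (fun i => (e.symm (σ i) : E)) := by
      symm
      refine Finset.sum_bij (fun σ _ => fun i => (e.symm (σ i) : E)) ?_ ?_ ?_ ?_
      · intro σ _
        have hinj : Function.Injective fun i => (e.symm (σ i) : E) :=
          Subtype.val_injective.comp (e.symm.injective.comp σ.injective)
        simp only [Finset.mem_filter, Finset.mem_univ, true_and]
        refine ⟨hinj, ?_⟩
        apply Finset.eq_of_subset_of_card_le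
        · intro x hx
          obtain ⟨i, _, rfl⟩ := Finset.mem_image.mp hx
          exact (e.symm (σ i)).2
        · rw [Finset.card_image_of_injective _ hinj, hB']; simp
      · intro σ _ τ _ h
        ext i
        have := congrFun h i
        have := e.symm.injective (Subtype.val_injective this)
        rw [this]
      · intro φ hφ
        simp only [Finset.mem_filter, Finset.mem_univ, true_and] at hφ
        obtain ⟨hinj, him⟩ := hφ
        have hmem : ∀ i, φ i ∈ B := fun i => him ▸ Finset.mem_image_of_mem φ (Finset.mem_univ i)
        have hb : Function.Bijective fun i => e ⟨φ i, hmem i⟩ := by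
          rw [← Finite.injective_iff_bijective]
          intro i j h
          exact hinj (congrArg Subtype.val (e.injective h))
        refine ⟨Equiv.ofBijective _ hb, Finset.mem_univ _, ?_⟩
        funext i
        simp
      · intro σ _; rfl
    rw [key]
    set M : Matrix (Fin r) (Fin r) K := Matrix.of fun i j : Fin r => w i (e.symm j : E) with hM
    have hc : cSq w B = M.det ^ 2 := by
      unfold cSq
      rw [dif_pos hB']
    have hx : ∏ x ∈ B, (MvPolynomial.X x : MvPolynomial E K) = ∏ i : Fin r, MvPolynomial.X (e.symm i : E) := by
      rw [← Finset.prod_coe_sort B, ← Equiv.prod_comp e.symm]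
    have hterm : ∀ σ : Equiv.Perm (Fin r), F (fun i => (e.symm (σ i) : E)) =
        (∏ x ∈ B, MvPolynomial.X x) * MvPolynomial.C (M.det * ((Equiv.Perm.sign σ : ℤ) * ∏ i, M i (σ i))) := by
      intro σ
      rw [hF]
      beta_reduce
      have h3 : (Matrix.of fun i j : Fin r => w j (e.symm (σ i) : E)) = M.transpose.submatrix σ id := by
        ext i j; rfl
      rw [h3, Matrix.det_permute, Matrix.det_transpose, Finset.prod_mul_distrib, hx,
        Equiv.prod_comp σ (fun i => (MvPolynomial.X (e.symm i : E) : MvPolynomial E K)), ← map_prod,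
        mul_comm (MvPolynomial.C _) (∏ i, _), mul_assoc, ← map_mul]
      congr 2
      simp only [hM, Matrix.of_apply]
      ring
    simp only [hterm]
    rw [← Finset.mul_sum, ← map_sum, ← Finset.mul_sum]
    have hdet : ∑ σ : Equiv.Perm (Fin r), ((Equiv.Perm.sign σ : ℤ) : K) * ∏ i, M i (σ i) = M.det := by
      rw [← Matrix.det_transpose, Matrix.det_apply']
      rfl
    rw [hdet, hc, pow_two, mul_comm]
  · intro φ hφ
    simp only [Finset.mem_filter, Finset.mem_univ, true_and] at hφ
    rw [Finset.mem_powersetCard]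
    refine ⟨Finset.subset_univ _, ?_⟩
    rw [Finset.card_image_of_injective _ hφ]; simp

lemma pderiv_psi {r : ℕ} (w : Fin r → E → K) (e : E) : MvPolynomial.pderiv e (psi w) =
    ∑ i, ∑ k, (Qform w).adjugate i k * MvPolynomial.C (w k e * w i e) := by
  rw [psi_eq_det, der_det]
  refine Finset.sum_congr rfl fun i _ => Finset.sum_congr rfl fun k _ => ?_
  congr 1
  simp only [Qform, Matrix.of_apply, map_sum]
  rw [Finset.sum_eq_single e]
  · rw [MvPolynomial.pderiv_C_mul, MvPolynomial.pderiv_X_self, mul_one]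
  · intro f _ hf
    rw [MvPolynomial.pderiv_C_mul, MvPolynomial.pderiv_X_of_ne hf, mul_zero]
  · simp

lemma det_ne_zero {r : ℕ} (w : Fin r → E → K) (hw : LinearIndependent K w) : (Qform w).det ≠ 0 := by
  classical
  have hs := span_cols w hw
  have h := Submodule.exists_fun_fin_finrank_span_eq K
    (Set.range fun (e : E) (i : Fin r) => w i e)
  have hfr : Module.finrank K (Submodule.span K (Set.range fun (e : E) (i : Fin r) => w i e)) = r := by
    rw [hs, finrank_top]; simp
  rw [hfr] at h
  obtain ⟨f, hf, _, hli⟩ := h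
  choose g hg using hf
  intro h0
  let x : E → K := fun e => ∑ i, if g i = e then 1 else 0
  let M : Matrix (Fin r) (Fin r) K := Matrix.of f
  have hM : IsUnit M := Matrix.linearIndependent_rows_iff_isUnit.mp hli
  have h1 : (Qform w).map (MvPolynomial.eval x) = M.transpose * M := by
    ext i j
    simp only [Matrix.map_apply, Qform, Matrix.of_apply, map_sum, map_mul, MvPolynomial.eval_C,
      MvPolynomial.eval_X, Matrix.mul_apply, Matrix.transpose_apply, M, x, Finset.mul_sum]
    rw [Finset.sum_comm]
    refine Finset.sum_congr rfl fun k _ => ?_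
    simp [← hg k]
  have h2 := congrArg (MvPolynomial.eval x) h0
  rw [RingHom.map_det, RingHom.mapMatrix_apply, h1, Matrix.det_mul, Matrix.det_transpose, map_zero] at h2
  have h3 := (Matrix.isUnit_iff_isUnit_det M).mp hM
  exact h3.ne_zero (mul_self_eq_zero.mp h2)

lemma minor_eq {m : ℕ} (w : Fin (m + 1) → E → K) : minorIdeal w =
    Ideal.span (Set.range fun p : Fin (m + 1) × Fin (m + 1) => (Qform w).adjugate p.1 p.2) := by
  have key : ∀ f : Fin m ↪ Fin (m + 1), ∃ (i : Fin (m + 1)) (σ : Equiv.Perm (Fin m)),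
      (f : Fin m → Fin (m + 1)) = i.succAbove ∘ σ := by
    intro f
    have : ¬ Function.Surjective f := by
      intro hs
      have := Fintype.card_le_of_surjective f hs
      simp at this
    rw [Function.Surjective] at this
    push Not at this
    obtain ⟨i, hi⟩ := this
    choose σ hσ using fun k => Fin.exists_succAbove_eq (hi k)
    have hb : Function.Bijective σ := by
      rw [← Finite.injective_iff_bijective]
      intro a b h
      apply f.injective
      rw [← hσ, ← hσ, h]
    refine ⟨i, Equiv.ofBijective σ hb, ?_⟩
    funext k
    simp [hσ]
  apply le_antisymm
  · unfold minorIdeal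
    rw [Ideal.span_le]
    rintro _ ⟨f, g, rfl⟩
    obtain ⟨i, σ, hσ⟩ := key f
    obtain ⟨j, τ, hτ⟩ := key g
    have e : (Qform w).submatrix f g =
      ((((Qform w).submatrix i.succAbove j.succAbove).submatrix σ id).submatrix id τ) := by
      rw [Matrix.submatrix_submatrix, Matrix.submatrix_submatrix]
      congr 1
    show ((Qform w).submatrix f g).det ∈ _
    have hA := Matrix.adjugate_fin_succ_eq_det_submatrix (Qform w) j i
    have hA2 : ((Qform w).submatrix i.succAbove j.succAbove).det = (-1) ^ (i + j : ℕ) * (Qform w).adjugate j i := by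
      rw [hA, ← mul_assoc, ← mul_pow]; simp
    have e2 : ((Qform w).submatrix f g).det = ((Equiv.Perm.sign τ : ℤ) : MvPolynomial E K) *
        (((Equiv.Perm.sign σ : ℤ) : MvPolynomial E K) * ((-1) ^ (i + j : ℕ) * (Qform w).adjugate j i)) := by
      refine (congrArg Matrix.det e).trans ?_
      refine (Matrix.det_permute' τ _).trans ?_
      rw [← hA2]
      congr 1
      exact Matrix.det_permute σ _
    rw [e2]
    exact Ideal.mul_mem_left _ _ (Ideal.mul_mem_left _ _ (Ideal.mul_mem_left _ _
      (Ideal.subset_span ⟨(j, i), rfl⟩)))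
  · rw [Ideal.span_le]
    rintro _ ⟨⟨i, j⟩, rfl⟩
    show (Qform w).adjugate i j ∈ _
    rw [Matrix.adjugate_fin_succ_eq_det_submatrix]
    exact Ideal.mul_mem_left _ _ (Ideal.subset_span ⟨j.succAboveEmb, i.succAboveEmb, rfl⟩)
end psi
end Config

open scoped BigOperators
set_option linter.unusedSectionVars false
namespace Config
section fin
variable {K : Type} [Field K] {E : Type} [Fintype E] [DecidableEq E]

lemma ht_ge {m : ℕ} (W : Submodule K (E → K)) (w : Fin (m + 1) → E → K)
    (hw : IsBasisOf w W) (hconn : Connected W) (P : Ideal (MvPolynomial E K)) (hP : P.IsPrime)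
    (hI : minorIdeal w ≤ P) : (3 : ℕ∞) ≤ P.height := by
  let S := MvPolynomial E K ⧸ P
  let L := FractionRing S
  let φ : MvPolynomial E K →ₐ[K] L := (IsScalarTower.toAlgHom K S L).comp (Ideal.Quotient.mkₐ K P)
  let x : E → L := fun e => φ (MvPolynomial.X e)
  have hφ : MvPolynomial.aeval x = φ := by
    apply MvPolynomial.algHom_ext
    intro e
    simp [x]
  have hzero : ∀ q, φ q = 0 ↔ q ∈ P := by
    intro q
    rw [← Ideal.Quotient.eq_zero_iff_mem]
    show algebraMap S L (Ideal.Quotient.mk P q) = 0 ↔ _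
    exact FaithfulSMul.algebraMap_eq_zero_iff S L
  have hker : RingHom.ker (MvPolynomial.aeval x : MvPolynomial E K →ₐ[K] L) = P := by
    ext q
    rw [RingHom.mem_ker, hφ, hzero]
  have hmat : (Matrix.of fun i j : Fin (m + 1) => ∑ e, algebraMap K L (w i e * w j e) * x e) =
      (φ : MvPolynomial E K →+* L).mapMatrix (Qform w) := by
    ext i j
    simp only [Matrix.of_apply, RingHom.mapMatrix_apply, Matrix.map_apply, Qform, map_sum, x]
    refine Finset.sum_congr rfl fun e _ => ?_
    rw [← φ.commutes (w i e * w j e)]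
    exact (map_mul φ _ _).symm
  have htd := td_bound w hw.1 (Nat.succ_pos m) (conn_of_connected W w hw hconn) x (by
    rw [hmat, ← RingHom.map_adjugate]
    ext i j
    rw [RingHom.mapMatrix_apply, Matrix.map_apply]
    refine (hzero _).mpr (hI ?_)
    rw [minor_eq]
    exact Ideal.subset_span ⟨(i, j), rfl⟩)
  have hc := card_le_height (K := K) E x
  rw [hker, Nat.card_eq_fintype_card] at hc
  have htd2 : td K (Set.range x) + 3 ≤ td K (Set.range x) + P.height := by
    refine htd.trans (hc.trans ?_)
    rw [add_comm]
  have hne : td K (Set.range x) ≠ ⊤ := by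
    intro h
    rw [h, top_add] at htd
    exact absurd htd (by simp)
  exact (ENat.add_le_add_iff_left hne).mp htd2

lemma minor_ne_top {m : ℕ} (w : Fin (m + 2) → E → K) : minorIdeal w ≠ ⊤ := by
  intro h
  have hle : minorIdeal w ≤ RingHom.ker (MvPolynomial.constantCoeff : MvPolynomial E K →+* K) := by
    unfold minorIdeal
    rw [Ideal.span_le]
    rintro _ ⟨f, g, rfl⟩
    show MvPolynomial.constantCoeff ((Qform w).submatrix f g).det = 0
    rw [RingHom.map_det]
    apply Matrix.det_eq_zero_of_row_eq_zero (⟨0, by omega⟩ : Fin (m + 2 - 1))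
    intro j
    simp [Qform]
  rw [h, top_le_iff] at hle
  exact RingHom.ker_ne_top _ hle

lemma jac_iff {m : ℕ} (w : Fin (m + 1) → E → K) (hw : LinearIndependent K w)
    (P : Ideal (MvPolynomial E K)) (hP : P.IsPrime) : jacIdeal w ≤ P ↔ minorIdeal w ≤ P := by
  have hQ := Qform_symm w
  set A := (Qform w).adjugate with hA
  have hm : minorIdeal w ≤ P ↔ ∀ i j, A i j ∈ P := by
    rw [minor_eq, Ideal.span_le]
    constructor
    · intro h i j; exact h ⟨(i, j), rfl⟩
    · rintro h _ ⟨⟨i, j⟩, rfl⟩; exact h i j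
  have hj : jacIdeal w ≤ P ↔ (Qform w).det ∈ P ∧ ∀ e,
      ∑ i, ∑ k, A i k * MvPolynomial.C (w k e * w i e) ∈ P := by
    unfold jacIdeal
    rw [Ideal.span_le, Set.union_subset_iff, Set.singleton_subset_iff, Set.range_subset_iff]
    simp only [pderiv_psi, SetLike.mem_coe]
    rw [psi_eq_det]
  rw [hm, hj]
  constructor
  · rintro ⟨hd, hD⟩
    have hAs : ∀ i j, A j i = A i j := fun i j => congrFun (congrFun (adj_symm _ hQ) i) j
    have hdB : ∀ k i j, A k k * A i j - A i k * A k j ∈ P := by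
      intro k i j
      have h := congrArg (fun X : Matrix (Fin (m+1)) (Fin (m+1)) (MvPolynomial E K) => X i j) (det_B _ hQ k)
      beta_reduce at h
      have h3 : ((Qform w).adjugate * Matrix.single k k 1 * (Qform w).adjugate :
          Matrix (Fin (m+1)) (Fin (m+1)) (MvPolynomial E K)) i j = A i k * A k j := by
        rw [Matrix.mul_assoc, Matrix.mul_apply, Finset.sum_eq_single k]
        · rw [Matrix.single_mul_apply_same, one_mul]
        · intro b _ hb
          rw [Matrix.single_mul_apply_of_ne _ _ _ _ _ hb, mul_zero]
        · simp
      rw [Matrix.smul_apply, Matrix.sub_apply, h3, Matrix.smul_apply, smul_eq_mul, smul_eq_mul] at h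
      rw [← h]
      exact Ideal.mul_mem_right _ _ hd
    have hdiag : ∀ k, A k k ∈ P := by
      intro k
      by_contra hk
      have hlin : ∀ e, ∑ i, A k i * MvPolynomial.C (w i e) ∈ P := by
        intro e
        apply hP.mem_of_pow_mem 2
        have h1 : (∑ i, A k i * MvPolynomial.C (w i e)) ^ 2 =
            A k k * (∑ i, ∑ j, A i j * MvPolynomial.C (w j e * w i e)) -
            ∑ i, ∑ j, (A k k * A i j - A i k * A k j) * MvPolynomial.C (w j e * w i e) := by
          rw [pow_two, Finset.sum_mul_sum, Finset.mul_sum, ← Finset.sum_sub_distrib]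
          refine Finset.sum_congr rfl fun i _ => ?_
          rw [Finset.mul_sum, ← Finset.sum_sub_distrib]
          refine Finset.sum_congr rfl fun j _ => ?_
          rw [hAs k i, map_mul]
          ring
        rw [h1]
        exact sub_mem (Ideal.mul_mem_left _ _ (hD e))
          (sum_mem fun i _ => sum_mem fun j _ => Ideal.mul_mem_right _ _ (hdB k i j))
      have hall : ∀ v : Fin (m + 1) → K, ∑ i, A k i * MvPolynomial.C (v i) ∈ P := by
        intro v
        have hv : v ∈ Submodule.span K (Set.range fun (e : E) (i : Fin (m + 1)) => w i e) := by
          rw [span_cols w hw]; trivial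
        induction hv using Submodule.span_induction with
        | mem v hv => obtain ⟨e, rfl⟩ := hv; exact hlin e
        | zero => simp
        | add x y _ _ hx hy =>
          have := add_mem hx hy
          rw [← Finset.sum_add_distrib] at this
          simpa [mul_add] using this
        | smul c x _ hx =>
          have := Ideal.mul_mem_left P (MvPolynomial.C c) hx
          rw [Finset.mul_sum] at this
          convert this using 2
          simp only [Pi.smul_apply, smul_eq_mul, map_mul]; ring
      apply hk
      have := hall (Pi.single k 1)
      rw [Finset.sum_eq_single k] at this
      · simpa using this
      · intro b _ hb; simp [hb]
      · simp
    intro i j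
    apply hP.mem_of_pow_mem 2
    have := hdB i j j
    have h2 := sub_mem (Ideal.mul_mem_right (A j j) P (hdiag i)) this
    have e : A i i * A j j - (A i i * A j j - A j i * A i j) = A i j ^ 2 := by
      rw [hAs i j]; ring
    rwa [e] at h2
  · intro h
    constructor
    · have h1 := Matrix.mul_adjugate_apply (Qform w) 0 0 0
      have h2 : ((Qform w) * A) 0 0 = (Qform w).det := by
        rw [hA, Matrix.mul_adjugate]; simp
      rw [← h2, Matrix.mul_apply]
      exact sum_mem fun i _ => Ideal.mul_mem_left _ _ (h _ _)
    · intro e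
      exact sum_mem fun i _ => sum_mem fun j _ => Ideal.mul_mem_right _ _ (h _ _)

lemma jac_min {m : ℕ} (w : Fin (m + 1) → E → K) (hw : LinearIndependent K w) :
    (jacIdeal w).minimalPrimes = (minorIdeal w).minimalPrimes := by
  have h2 : ∀ p : Ideal (MvPolynomial E K), (p.IsPrime ∧ jacIdeal w ≤ p) ↔ (p.IsPrime ∧ minorIdeal w ≤ p) :=
    fun p => and_congr_right fun hp => jac_iff w hw p hp
  ext p
  unfold Ideal.minimalPrimes
  constructor
  · rintro ⟨h, h'⟩
    exact ⟨(h2 p).mp h, fun q hq hle => h' ((h2 q).mpr hq) hle⟩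
  · rintro ⟨h, h'⟩
    exact ⟨(h2 p).mpr h, fun q hq hle => h' ((h2 q).mp hq) hle⟩

end fin
end Config

open scoped BigOperators
namespace Config
variable {K : Type} [Field K] {E : Type} [Fintype E] [DecidableEq E]

/-- **Theorem (Cohen–Macaulayness of degeneracy schemes).**
Let `W ⊆ K^E` be a configuration realizing a connected matroid of rank at least `2`.
Then the ideal `M_W` of submaximal minors of the configuration form `Q_W` has height `3`
in `K[x_e : e ∈ E]`, the quotient `K[x]/M_W` is Cohen–Macaulay, and the Jacobian ideal
`J_W` is equidimensional of height `3`: every minimal prime over `J_W` has height `3`. -/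
theorem minorIdeal_height_eq_three_and_cohenMacaulay_of_connected
    (W : Submodule K (E → K)) {r : ℕ} (w : Fin r → E → K)
    (hw : IsBasisOf w W) (hconn : Connected W) (hrk : 2 ≤ r) :
    htI (minorIdeal w) = 3 ∧
    IsCohenMacaulayRing (MvPolynomial E K ⧸ minorIdeal w) ∧
    (∀ p ∈ (jacIdeal w).minimalPrimes, ∀ hp : p.IsPrime, htP p hp = 3) := by
  obtain ⟨m, rfl⟩ : ∃ m, r = m + 2 := ⟨r - 2, by omega⟩
  have hG : GG (MvPolynomial E K) := GG.mv E
  have hht := ht_ge W w hw hconn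
  have hEV : ∀ (N : Type) [AddCommGroup N] [Module (MvPolynomial E K) N] (k : ℕ),
      EV (MvPolynomial E K) N (MvPolynomial E K) (k + 3) →
      EV (MvPolynomial E K) N (MvPolynomial E K ⧸ minorIdeal w) k := by
    intro N _ _ k h
    exact EV_minor (Qform w) (Qform_symm w) (det_ne_zero w hw.1) hG (minorIdeal w) (minor_eq w) hht N k h
  refine ⟨htI_eq hG _ hEV hht (minor_ne_top w), cm_of hG _ hEV hht, ?_⟩
  intro p hp hpp
  rw [htP_eq]
  rw [jac_min w hw.1] at hp
  exact min_ht hG _ hEV hht p hp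

end Config
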